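/- arXiv:2210.05558 — 9 statements merged into one kernel-verified Lean document; each statement's English description precedes it below -/
import Mathlib

section
/- Sufficiency of an identified complete-case missingness mechanism for target-law identification: let P and Q be two probability mass functions on S × {0,1}^K, where S = α_1 × ⋯ × α_K is a finite product space, for a pair (Z, R) of a full-data vector and missingness indicators. Suppose (i) for every z ∈ S, P(Z = z) > 0 and Q(Z = z) > 0; (ii) P(R = 1 | Z = z) > 0, Q(R = 1 | Z = z) > 0, and P(R = 1 | Z = z) = Q(R = 1 | Z = z) for every z; and (iii) P and Q induce the same observed-data law, i.e., the distributions of (R, L) under P and Q coincide, where L is the proxy vector of (Z, R). Then the target laws agree: P(Z = z) = Q(Z = z) for every z ∈ S. -/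
/-- `psum f A` is the probability of the event `A` under the probability mass function `f`. -/
noncomputable def psum {β : Type*} [Fintype β] (f : β → ℝ) (A : Set β) : ℝ :=
  ∑ b, A.indicator f b

/-- The proxy vector of `(z, r)`: coordinate `k` equals `some (z k)` if `r k = 1`
and the distinguished point `?` (here `none`) if `r k = 0`. -/
def mdProxy {K : ℕ} {α : Fin K → Type*} (z : ∀ k, α k) (r : Fin K → Bool) :
    ∀ k, Option (α k) :=
  fun k => if r k then some (z k) else none

/-- On complete cases the observed-data law is the full-data law. -/
theorem psum_completeCase {K : ℕ} {α : Fin K → Type*} [∀ k, Fintype (α k)]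
    (f : ((∀ k, α k) × (Fin K → Bool)) → ℝ) (z : ∀ k, α k) :
    psum f {s | s.2 = (fun _ => true) ∧ mdProxy s.1 s.2 = fun k => some (z k)}
      = f (z, fun _ => true) := by
  classical
  have hset : {s : (∀ k, α k) × (Fin K → Bool) |
      s.2 = (fun _ => true) ∧ mdProxy s.1 s.2 = fun k => some (z k)} = {(z, fun _ => true)} := by
    ext ⟨x, r⟩
    simp only [Set.mem_ofPred_eq, Set.mem_singleton_iff, Prod.mk.injEq]
    constructor
    · rintro ⟨rfl, h⟩
      exact ⟨funext fun k => by simpa [mdProxy] using congrFun h k, rfl⟩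
    · rintro ⟨rfl, rfl⟩
      exact ⟨rfl, funext fun k => by simp [mdProxy]⟩
  rw [psum, hset]
  simp [Set.indicator_apply]

/-- sufficiency of an identified complete-case missingness mechanism for
target-law identification. -/
theorem target_law_identified_of_complete_case_mechanism
    {K : ℕ} {α : Fin K → Type*} [∀ k, Fintype (α k)] [∀ k, Nonempty (α k)]
    (P Q : ((∀ k, α k) × (Fin K → Bool)) → ℝ)
    (hPnn : ∀ s, 0 ≤ P s) (hQnn : ∀ s, 0 ≤ Q s)
    (hPsum : ∑ s, P s = 1) (hQsum : ∑ s, Q s = 1)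
    -- (i) positive target laws
    (hPz : ∀ z : (∀ k, α k), 0 < ∑ r, P (z, r))
    (hQz : ∀ z : (∀ k, α k), 0 < ∑ r, Q (z, r))
    -- (ii) positive and identical complete-case missingness mechanisms
    (hPr1 : ∀ z : (∀ k, α k), 0 < P (z, fun _ => true) / ∑ r, P (z, r))
    (hQr1 : ∀ z : (∀ k, α k), 0 < Q (z, fun _ => true) / ∑ r, Q (z, r))
    (hmech : ∀ z : (∀ k, α k),
      P (z, fun _ => true) / (∑ r, P (z, r)) = Q (z, fun _ => true) / (∑ r, Q (z, r)))
    -- (iii) identical observed-data laws of (R, L)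
    (hobs : ∀ (r : Fin K → Bool) (l : ∀ k, Option (α k)),
      psum P {s | s.2 = r ∧ mdProxy s.1 s.2 = l}
        = psum Q {s | s.2 = r ∧ mdProxy s.1 s.2 = l}) :
    ∀ z : (∀ k, α k), (∑ r, P (z, r)) = ∑ r, Q (z, r) := by
  intro z
  have h1 : P (z, fun _ => true) = Q (z, fun _ => true) := by
    simpa only [psum_completeCase] using hobs (fun _ => true) fun k => some (z k)
  have hm := hmech z
  have hPpos := (div_pos_iff_of_pos_right (hPz z)).1 (hPr1 z)
  rw [← h1, div_eq_div_iff (hPz z).ne' (hQz z).ne'] at hm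
  exact (mul_left_cancel₀ hPpos.ne' hm).symm
end

section
/- Sufficiency of an identified missingness mechanism for full-law identification: let P and Q be two probability mass functions on S × {0,1}^K, where S = α_1 × ⋯ × α_K is a finite product space, for a pair (Z, R). Suppose (i) for every z ∈ S, P(Z = z) > 0 and Q(Z = z) > 0; (ii) P(R = 1 | Z = z) > 0 and Q(R = 1 | Z = z) > 0 for every z; (iii) P(R = r | Z = z) = Q(R = r | Z = z) for every z ∈ S and every r ∈ {0,1}^K; and (iv) P and Q induce the same observed-data law, i.e., the distributions of (R, L) under P and Q coincide, where L is the proxy vector. Then the full laws agree: P(Z = z, R = r) = Q(Z = z, R = r) for every z and r. -/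
theorem psum_singleton {β : Type*} [Fintype β] (f : β → ℝ) (b : β) : psum f {b} = f b := by
  rw [psum, Finset.sum_eq_single b]
  · simp
  · intro c _ hc
    simp [hc]
  · simp

theorem mdProxy_true_injective {K : ℕ} {α : Fin K → Type*} :
    Function.Injective fun z : (∀ k, α k) => mdProxy z (fun _ => true) := by
  intro w z h
  funext k
  simpa [mdProxy] using congrFun h k

/-- sufficiency of an identified missingness mechanism for
full-law identification. -/
theorem full_law_identified_of_mechanism
    {K : ℕ} {α : Fin K → Type*} [∀ k, Fintype (α k)] [∀ k, Nonempty (α k)]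
    (P Q : ((∀ k, α k) × (Fin K → Bool)) → ℝ)
    (hPnn : ∀ s, 0 ≤ P s) (hQnn : ∀ s, 0 ≤ Q s)
    (hPsum : ∑ s, P s = 1) (hQsum : ∑ s, Q s = 1)
    -- (i) positive target laws
    (hPz : ∀ z : (∀ k, α k), 0 < ∑ r, P (z, r))
    (hQz : ∀ z : (∀ k, α k), 0 < ∑ r, Q (z, r))
    -- (ii) positive complete-case missingness mechanisms
    (hPr1 : ∀ z : (∀ k, α k), 0 < P (z, fun _ => true) / ∑ r, P (z, r))
    (hQr1 : ∀ z : (∀ k, α k), 0 < Q (z, fun _ => true) / ∑ r, Q (z, r))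
    -- (iii) identical missingness mechanisms at every pattern r
    (hmech : ∀ (z : ∀ k, α k) (r : Fin K → Bool),
      P (z, r) / (∑ r', P (z, r')) = Q (z, r) / (∑ r', Q (z, r')))
    -- (iv) identical observed-data laws of (R, L)
    (hobs : ∀ (r : Fin K → Bool) (l : ∀ k, Option (α k)),
      psum P {s | s.2 = r ∧ mdProxy s.1 s.2 = l}
        = psum Q {s | s.2 = r ∧ mdProxy s.1 s.2 = l}) :
    ∀ (z : ∀ k, α k) (r : Fin K → Bool), P (z, r) = Q (z, r) := by
  have hsingle : ∀ z : (∀ k, α k),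
      {s : (∀ k, α k) × (Fin K → Bool) | s.2 = (fun _ => true) ∧
        mdProxy s.1 s.2 = mdProxy z (fun _ => true)} = {(z, fun _ => true)} := by
    intro z
    ext ⟨w, r⟩
    simp only [Set.mem_ofPred_eq, Set.mem_singleton_iff, Prod.mk.injEq]
    constructor
    · rintro ⟨rfl, h⟩
      exact ⟨mdProxy_true_injective h, rfl⟩
    · rintro ⟨rfl, rfl⟩
      exact ⟨rfl, rfl⟩
  have hcomplete : ∀ z : (∀ k, α k), P (z, fun _ => true) = Q (z, fun _ => true) := by
    intro z
    have h := hobs (fun _ => true) (mdProxy z (fun _ => true))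
    rwa [hsingle z, psum_singleton, psum_singleton] at h
  intro z r
  have hPne := (hPz z).ne'
  have hQne := (hQz z).ne'
  have hQ1 : Q (z, fun _ => true) ≠ 0 := fun h => by
    have h1 := hQr1 z
    rw [h, zero_div] at h1
    exact h1.false
  have hmarg : ∑ r', P (z, r') = ∑ r', Q (z, r') := by
    have h := hmech z (fun _ => true)
    rw [hcomplete z, div_eq_div_iff hPne hQne] at h
    exact (mul_left_cancel₀ hQ1 h).symm
  have h := hmech z r
  rw [hmarg] at h
  exact (div_left_inj' hQne).mp h
end

section
/- Invariance property (Lemma 1), factorized form: let V_1,…,V_n take values in finite nonempty sets α_1,…,α_n, with joint probability mass function p(v) = ∏_{i=1}^n f_i(v_i ; v_{pa(i)}), where pa(i) ⊆ {1,…,i−1} and each f_i(· ; c) is a probability mass function in its first argument. Fix a subset S ⊆ {1,…,n} and a value s ∈ ∏_{j∈S} α_j, and define the truncated (interventional) kernel on ∏_{i∉S} α_i by q(v_{∉S}) := ∏_{i∉S} f_i(v_i ; w_{pa(i)}), where w is the assignment agreeing with v on indices outside S and with s on S. Then (a) q is a probability mass function, and (b) for every k ∉ S, every value x ∈ α_k,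 and every configuration c of the coordinates pa(k)∖S with strictly positive q-marginal probability, the conditional of V_k given its non-intervened parents under q equals the original factor: q(V_k = x | V_{pa(k)∖S} = c) = f_k(x ; (c, s)_{pa(k)}), where (c, s)_{pa(k)} is the parent configuration built from c on pa(k)∖S and from s on pa(k)∩S. -/
open Finset Function in
/-- Averaging out the coordinate `k`: summing over all `v` is the same, up to the factor
`card (β k)`, as first summing over the `k`-th coordinate. -/
theorem card_mul_sum_mul_apply {ι : Type*} [Fintype ι] [DecidableEq ι] {β : ι → Type*}
    [∀ i, Fintype (β i)] (k : ι) (F : (∀ i, β i) → ℝ) (G : β k → (∀ i, β i) → ℝ)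
    (hF : ∀ v a, F (update v k a) = F v) (hG : ∀ b v a, G b (update v k a) = G b v) :
    (Fintype.card (β k) : ℝ) * ∑ v, F v * G (v k) v = ∑ v, F v * ∑ a, G a v := by
  let swap : β k × (∀ i, β i) ≃ β k × (∀ i, β i) :=
    { toFun := fun z => (z.2 k, update z.2 k z.1)
      invFun := fun z => (z.2 k, update z.2 k z.1)
      left_inv := fun z => by simp
      right_inv := fun z => by simp }
  calc (Fintype.card (β k) : ℝ) * ∑ v, F v * G (v k) v
      = ∑ z : β k × (∀ i, β i), F z.2 * G (z.2 k) z.2 := by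
        rw [Fintype.sum_prod_type]; simp
    _ = ∑ z : β k × (∀ i, β i), F z.2 * G z.1 z.2 := by
        refine Fintype.sum_equiv swap _ _ fun z => ?_
        simp [swap, hF, hG]
    _ = ∑ v, F v * ∑ a, G a v := by
        rw [Fintype.sum_prod_type_right]; simp [mul_sum]

section RecursiveFactorization

open Finset Function

variable {ι : Type*} [Fintype ι] [LinearOrder ι] {β : ι → Type*} [∀ i, Fintype (β i)]
  (g : ∀ i, β i → (∀ j, β j) → ℝ)

/-- In a recursive product of conditional mass functions, the factors in an upper set `D` sum out
against any function not depending on the coordinates in `D`. -/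
theorem sum_mul_prod_mul_card_of_isUpperSet
    (hg : ∀ i b v j a, i ≤ j → g i b (update v j a) = g i b v)
    (hg1 : ∀ i v, ∑ b, g i b v = 1) (h : (∀ i, β i) → ℝ) (D : Finset ι)
    (hD : IsUpperSet (D : Set ι)) (hh : ∀ v, ∀ j ∈ D, ∀ a, h (update v j a) = h v) :
    (∏ i ∈ D, (Fintype.card (β i) : ℝ)) * ∑ v, h v * ∏ i, g i (v i) v
      = ∑ v, h v * ∏ i ∈ Dᶜ, g i (v i) v := by
  induction D using Finset.induction_on_min with
  | empty => simp
  | insert k D hk ih =>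
    have hkD : k ∉ D := fun hm => lt_irrefl _ (hk k hm)
    have hlt : ∀ i ∈ (insert k D)ᶜ, i < k := fun i hi => by
      by_contra! hki
      exact mem_compl.1 hi (mem_coe.1 (hD hki (by simp)))
    have hD' : IsUpperSet (D : Set ι) := fun i j hij hi => by
      have hj : j ∈ insert k D := mem_coe.1 (hD hij (by simp [mem_coe.1 hi]))
      rcases mem_insert.1 hj with rfl | hj
      · exact absurd (hk i hi) hij.not_gt
      · exact hj
    rw [prod_insert hkD, mul_assoc, ih hD' fun v j hj a => hh v j (mem_insert_of_mem hj) a]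
    have hc : Dᶜ = insert k (insert k D)ᶜ := by
      ext i; by_cases hi : i = k <;> simp [hi, hkD]
    have hF : ∀ v a, h (update v k a) *
        ∏ i ∈ (insert k D)ᶜ, g i (update v k a i) (update v k a)
          = h v * ∏ i ∈ (insert k D)ᶜ, g i (v i) v := fun v a => by
      rw [hh v k (mem_insert_self k D) a]
      congr 1
      refine prod_congr rfl fun i hi => ?_
      rw [update_of_ne (hlt i hi).ne, hg i _ v k a (hlt i hi).le]
    have key := card_mul_sum_mul_apply k
      (fun v => h v * ∏ i ∈ (insert k D)ᶜ, g i (v i) v) (g k) hF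
      fun b v a => hg k b v k a le_rfl
    simp only [hg1, mul_one] at key
    rw [← key, hc]
    congr 1
    refine sum_congr rfl fun v _ => ?_
    rw [prod_insert (by simp)]
    ring

/-- A recursive product of conditional mass functions has total mass one. -/
theorem sum_prod_eq_one [∀ i, Nonempty (β i)]
    (hg : ∀ i b v j a, i ≤ j → g i b (update v j a) = g i b v)
    (hg1 : ∀ i v, ∑ b, g i b v = 1) : ∑ v, ∏ i, g i (v i) v = 1 := by
  have hC : (∏ i, (Fintype.card (β i) : ℝ)) ≠ 0 := prod_ne_zero_iff.2 fun i _ => by simp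
  have := sum_mul_prod_mul_card_of_isUpperSet g hg hg1 (fun _ => 1) univ
    (by simpa using isUpperSet_univ) (by simp)
  refine mul_left_cancel₀ hC ?_
  simpa [Fintype.card_pi] using this

/-- If `h` depends only on coordinates before `k`, and the `k`-th factor at `x` is constantly `r`
on the support of `h`, then restricting to `v k = x` multiplies the `h`-weighted mass by `r`. -/
theorem sum_ite_mul_prod_eq [∀ i, Nonempty (β i)]
    (hg : ∀ i b v j a, i ≤ j → g i b (update v j a) = g i b v)
    (hg1 : ∀ i v, ∑ b, g i b v = 1) (h : (∀ i, β i) → ℝ) (k : ι)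
    [DecidableEq (β k)] (x : β k) (r : ℝ)
    (hh : ∀ v j a, k ≤ j → h (update v j a) = h v) (hr : ∀ v, h v ≠ 0 → g k x v = r) :
    ∑ v, (h v * if v k = x then 1 else 0) * ∏ i, g i (v i) v
      = r * ∑ v, h v * ∏ i, g i (v i) v := by
  have hC : ∀ D : Finset ι, (∏ i ∈ D, (Fintype.card (β i) : ℝ)) ≠ 0 := fun D =>
    prod_ne_zero_iff.2 fun i _ => by simp
  let D : Finset ι := univ.filter (k < ·)
  have hkD : k ∉ D := by simp [D]
  have hins : ∀ i, i ∈ insert k D ↔ k ≤ i := fun i => by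
    simp [D, le_iff_eq_or_lt, eq_comm]
  have hnum := sum_mul_prod_mul_card_of_isUpperSet g hg hg1
    (fun v => h v * if v k = x then 1 else 0) D
    (fun i j hij hi => by
      simp only [D, coe_filter, mem_univ, true_and, Set.mem_ofPred_eq] at hi ⊢
      exact hi.trans_le hij)
    (fun v j hj a => by
      have hj : k < j := by simpa [D] using hj
      simp only [hh v j a hj.le, update_of_ne hj.ne])
  have hden := sum_mul_prod_mul_card_of_isUpperSet g hg hg1 h (insert k D)
    (fun i j hij hi => mem_coe.2 ((hins j).2 (((hins i).1 (mem_coe.1 hi)).trans hij)))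
    (fun v j hj a => hh v j a ((hins j).1 hj))
  have hc : Dᶜ = insert k (insert k D)ᶜ := by
    ext i; by_cases hi : i = k <;> simp [hi, hkD]
  have hlt : ∀ i ∈ (insert k D)ᶜ, i < k := fun i hi => by
    simpa only [mem_compl, hins, not_le] using hi
  have key := card_mul_sum_mul_apply k
    (fun v => h v * ∏ i ∈ (insert k D)ᶜ, g i (v i) v)
    (fun b v => (if b = x then 1 else 0) * g k b v)
    (fun v a => by
      rw [hh v k a le_rfl]
      congr 1
      refine prod_congr rfl fun i hi => ?_
      rw [update_of_ne (hlt i hi).ne, hg i _ v k a (hlt i hi).le])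
    (fun b v a => by rw [hg k b v k a le_rfl])
  refine mul_left_cancel₀ (hC (insert k D)) ?_
  rw [mul_left_comm, hden, prod_insert hkD, mul_assoc, hnum, mul_sum _ _ r]
  trans ∑ v, (h v * ∏ i ∈ (insert k D)ᶜ, g i (v i) v) * ∑ b, (if b = x then 1 else 0) * g k b v
  · rw [← key, hc]
    congr 1
    refine sum_congr rfl fun v _ => ?_
    rw [prod_insert (by simp)]
    ring
  · refine sum_congr rfl fun v _ => ?_
    by_cases hv : h v = 0
    · simp [hv]
    · simp [hr v hv, mul_comm]

end RecursiveFactorization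

/-- the invariance property (Lemma 1), factorized form.  Given a DAG-factorized
mass function `p v = ∏ i, f i (v i) v` (factor `i` depending only on the parent coordinates
`pa i ⊆ {0,…,i-1}`), a set `S` of intervened indices and intervention values `s`, the
truncated kernel `q v = ∏_{i ∉ S} f i (v i) (ext v)` (where `ext v` agrees with `v` off `S`
and with `s` on `S`) is a probability mass function, and for every non-intervened vertex
`k ∉ S` the conditional of `V k` given its non-intervened parents under `q` equals the
original factor `f k` evaluated at the parent configuration built from `c` and `s`. -/
theorem invariance_property
    {n : ℕ} {α : Fin n → Type*} [∀ i, Fintype (α i)] [∀ i, Nonempty (α i)]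
    (pa : Fin n → Finset (Fin n)) (hpa : ∀ i, ∀ j ∈ pa i, j < i)
    (f : ∀ i : Fin n, α i → (∀ j, α j) → ℝ)
    (hloc : ∀ (i : Fin n) (a : α i) (x y : ∀ j, α j),
      (∀ j ∈ pa i, x j = y j) → f i a x = f i a y)
    (hnn : ∀ (i : Fin n) (a : α i) (x : ∀ j, α j), 0 ≤ f i a x)
    (hsum1 : ∀ (i : Fin n) (x : ∀ j, α j), ∑ a, f i a x = 1)
    (p : (∀ i, α i) → ℝ) (hp : ∀ v, p v = ∏ i, f i (v i) v)
    (S : Finset (Fin n)) (s : ∀ i, α i)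
    (ext : (∀ t : {i : Fin n // i ∉ S}, α t.1) → ∀ i, α i)
    (hext : ∀ v (i : Fin n), ext v i = if h : i ∈ S then s i else v ⟨i, h⟩)
    (q : (∀ t : {i : Fin n // i ∉ S}, α t.1) → ℝ)
    (hq : ∀ v, q v = ∏ t, f t.1 (v t) (ext v)) :
    -- (a) the truncated kernel is a probability mass function
    ((∀ v, 0 ≤ q v) ∧ ∑ v, q v = 1) ∧
    -- (b) invariance of the propensity of each non-intervened vertex
    (∀ (k : Fin n) (hk : k ∉ S) (x : α k) (c : ∀ i, α i),
      0 < (∑ v, Set.indicator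
            {v' | ∀ (j : Fin n) (_ : j ∈ pa k) (hj' : j ∉ S), v' ⟨j, hj'⟩ = c j} q v) →
      (∑ v, Set.indicator
          {v' | v' ⟨k, hk⟩ = x ∧
            ∀ (j : Fin n) (_ : j ∈ pa k) (hj' : j ∉ S), v' ⟨j, hj'⟩ = c j} q v)
        / (∑ v, Set.indicator
            {v' | ∀ (j : Fin n) (_ : j ∈ pa k) (hj' : j ∉ S), v' ⟨j, hj'⟩ = c j} q v)
        = f k x (fun i => if i ∈ S then s i else c i)) := by
  classical
  let g : ∀ t : {i : Fin n // i ∉ S}, α t.1 → (∀ t : {i : Fin n // i ∉ S}, α t.1) → ℝ :=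
    fun t a v => f t.1 a (ext v)
  have hg : ∀ t b v j a, t ≤ j → g t b (Function.update v j a) = g t b v := by
    intro t b v j a htj
    refine hloc t.1 b _ _ fun i hi => ?_
    rw [hext, hext]
    split_ifs with hiS
    · rfl
    · exact Function.update_of_ne
        (fun e => ((hpa t.1 i hi).trans_le htj).ne (congrArg Subtype.val e)) _ _
  have hg1 : ∀ t v, ∑ b, g t b v = 1 := fun t v => hsum1 t.1 (ext v)
  have hqg : ∀ v, q v = ∏ t, g t (v t) v := hq
  refine ⟨⟨fun v => hq v ▸ Finset.prod_nonneg fun t _ => hnn _ _ _, ?_⟩, ?_⟩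
  · simp only [hqg]
    exact sum_prod_eq_one g hg hg1
  intro k hk x c hpos
  rw [div_eq_iff hpos.ne']
  have key := sum_ite_mul_prod_eq g hg hg1
    (fun v => if ∀ (j : Fin n) (_ : j ∈ pa k) (hj' : j ∉ S), v ⟨j, hj'⟩ = c j then 1 else 0)
    ⟨k, hk⟩ x (f k x (fun i => if i ∈ S then s i else c i))
    (fun v j a hkj => by
      have hne : ∀ i (hi : i ∈ pa k) (hi' : i ∉ S),
          Function.update v j a ⟨i, hi'⟩ = v ⟨i, hi'⟩ := fun i hi hi' =>
        Function.update_of_ne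
          (fun e => ((hpa k i hi).trans_le hkj).ne (congrArg Subtype.val e)) _ _
      congr 1
      refine propext (forall_congr' fun i => forall_congr' fun hi => forall_congr' fun hi' => ?_)
      exact iff_of_eq (congrArg (· = c i) (hne i hi hi')))
    (fun v hv => by
      have hv : ∀ (j : Fin n) (_ : j ∈ pa k) (hj' : j ∉ S), v ⟨j, hj'⟩ = c j := by
        by_contra hcon
        exact hv (if_neg hcon)
      refine hloc k x _ _ fun i hi => ?_
      rw [hext]
      split_ifs with hiS
      · rfl
      · exact hv i hi hiS)
  refine (Finset.sum_congr rfl fun v _ => ?_).trans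
    (key.trans (congrArg _ (Finset.sum_congr rfl fun v _ => ?_)))
  · rw [Set.indicator_apply, ← hqg]
    simp only [Set.mem_ofPred_eq, ite_and]
    split_ifs <;> simp
  · rw [Set.indicator_apply, ← hqg]
    simp only [Set.mem_ofPred_eq]
    split_ifs <;> simp
end

section
/- Target-law identification in the two-variable permutation model: let X_1, X_2 be full-data variables with missingness indicators R_1, R_2 ∈ {0,1}, and suppose the joint law of (X_1, X_2, R_1, R_2) is strictly positive on its finite product state space. Assume (P1) P(R_1 = 1 | X_1 = x_1, X_2 = x_2) = P(R_1 = 1 | X_2 = x_2) for all x_1, x_2; and (P2) there exist a function h_1 and a constant h_0 with P(R_2 = 1 | X_1 = x_1, X_2 = x_2, R_1 = 1) = h_1(x_1) and P(R_2 = 1 | X_1 = x_1, X_2 = x_2, R_1 = 0) = h_0 for all x_1, x_2. Then for all x_1, x_2: P(X_1 = x_1, X_2 = x_2) = P(X_1 = x_1, X_2 = x_2, R_1 = 1, R_2 = 1) / [ P(R_2 = 1 | R_1 = 1, X_1 = x_1) · W(x_2) ], where W(x_2) := T_1(x_2) / (T_1(x_2) + T_0(x_2)), T_1(x_2) := Σ_{x_1'}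 P(X_2 = x_2 | R_2 = 1, R_1 = 1, X_1 = x_1') · P(R_1 = 1, X_1 = x_1'), and T_0(x_2) := P(X_2 = x_2 | R_2 = 1, R_1 = 0) · P(R_1 = 0). Moreover W(x_2) = P(R_1 = 1 | X_2 = x_2), and every probability on the right-hand side conditions each X_k on the event R_k = 1, hence equals the same expression with X_k replaced by its proxy L_k. -/
open MeasureTheory

/-- `Pr P A` is the probability of the event `A` under the probability measure `P`. -/
noncomputable def Pr {Ω : Type*} [MeasurableSpace Ω] (P : Measure Ω) (A : Set Ω) : ℝ :=
  (P A).toReal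

/-- `cPr P A B` is the conditional probability `P(A | B) = P(A ∩ B) / P(B)`. -/
noncomputable def cPr {Ω : Type*} [MeasurableSpace Ω] (P : Measure Ω) (A B : Set Ω) : ℝ :=
  Pr P (A ∩ B) / Pr P B

section Helpers

variable {Ω : Type*} [MeasurableSpace Ω] {P : Measure Ω}

/-- Law of total probability over the fibres of a finitely-valued random variable. -/
lemma Pr_eq_sum_inter_fiber [IsFiniteMeasure P] {α : Type*} [Fintype α] {X : Ω → α}
    (hX : ∀ a, MeasurableSet {ω | X ω = a}) (A : Set Ω) :
    Pr P A = ∑ a, Pr P (A ∩ {ω | X ω = a}) := by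
  have hU : (⋃ a, {ω | X ω = a}) = Set.univ := by ext; simp
  have h : P A = ∑ a, P (A ∩ {ω | X ω = a}) := by
    calc P A = P.restrict A (⋃ a, {ω | X ω = a}) := by rw [hU, Measure.restrict_apply_univ]
      _ = ∑ a, P.restrict A {ω | X ω = a} := by
        rw [measure_iUnion _ hX, tsum_fintype]
        intro a b hab
        exact Set.disjoint_left.2 fun ω ha hb => hab (ha.symm.trans hb)
      _ = ∑ a, P (A ∩ {ω | X ω = a}) := by
        simp only [Measure.restrict_apply (hX _), Set.inter_comm]
  simp only [Pr]
  rw [h, ENNReal.toReal_sum fun a _ => measure_ne_top P _]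

lemma Pr_pos_of_subset [IsFiniteMeasure P] {A B : Set Ω} (hA : 0 < Pr P A) (h : A ⊆ B) :
    0 < Pr P B :=
  hA.trans_le (ENNReal.toReal_mono (measure_ne_top P _) (measure_mono h))

lemma Pr_inter_eq_mul_of_cPr_eq {E B : Set Ω} {c : ℝ} (hB : Pr P B ≠ 0) (h : cPr P E B = c) :
    Pr P (E ∩ B) = c * Pr P B :=
  (div_eq_iff hB).1 h

/-- If the conditional probability of `E` given `B ∩ {X = a}` does not depend on `a`, it is also
the conditional probability of `E` given `B`. -/
lemma Pr_inter_eq_mul_of_fiberwise [IsFiniteMeasure P] {α : Type*} [Fintype α] {X : Ω → α}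
    (hX : ∀ a, MeasurableSet {ω | X ω = a}) {E B : Set Ω} {c : ℝ}
    (h : ∀ a, Pr P (E ∩ (B ∩ {ω | X ω = a})) = c * Pr P (B ∩ {ω | X ω = a})) :
    Pr P (E ∩ B) = c * Pr P B := by
  rw [Pr_eq_sum_inter_fiber hX (E ∩ B), Pr_eq_sum_inter_fiber hX B, Finset.mul_sum]
  exact Finset.sum_congr rfl fun a _ => by rw [Set.inter_assoc, h a]

/-- If `E` has the same nonzero conditional probability given `B` and given `B ∩ C`, then
conditioning on `E` in addition to `B` does not change the probability of `C`. -/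
lemma cPr_mul_Pr_eq_Pr_inter {E B C : Set Ω} {c : ℝ} (hc : c ≠ 0) (hB : Pr P B ≠ 0)
    (h : Pr P (E ∩ B) = c * Pr P B) (hC : Pr P (E ∩ (B ∩ C)) = c * Pr P (B ∩ C)) :
    cPr P C (E ∩ B) * Pr P B = Pr P (B ∩ C) := by
  have hset : C ∩ (E ∩ B) = E ∩ (B ∩ C) := by rw [Set.inter_comm, Set.inter_assoc]
  rw [cPr, hset, hC, h]
  field_simp

end Helpers

/-- target-law identification in the two-variable permutation model. -/
theorem permutation_model_two_var_id
    {Ω : Type*} [MeasurableSpace Ω] (P : Measure Ω) [IsProbabilityMeasure P]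
    {α₁ α₂ : Type*} [Fintype α₁] [Nonempty α₁] [Fintype α₂] [Nonempty α₂]
    (X₁ : Ω → α₁) (X₂ : Ω → α₂) (R₁ R₂ : Ω → Bool)
    (L₁ : Ω → Option α₁) (L₂ : Ω → Option α₂)
    (hmX₁ : ∀ a, MeasurableSet {ω | X₁ ω = a})
    (hmX₂ : ∀ a, MeasurableSet {ω | X₂ ω = a})
    (hmR₁ : ∀ b, MeasurableSet {ω | R₁ ω = b})
    (hmR₂ : ∀ b, MeasurableSet {ω | R₂ ω = b})
    -- consistency: proxies
    (hL₁ : ∀ ω, L₁ ω = if R₁ ω then some (X₁ ω) else none)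
    (hL₂ : ∀ ω, L₂ ω = if R₂ ω then some (X₂ ω) else none)
    -- strict positivity of the joint law
    (hpos : ∀ (x₁ : α₁) (x₂ : α₂) (r₁ r₂ : Bool),
      0 < Pr P {ω | X₁ ω = x₁ ∧ X₂ ω = x₂ ∧ R₁ ω = r₁ ∧ R₂ ω = r₂})
    -- (P1)
    (hP1 : ∀ (x₁ : α₁) (x₂ : α₂),
      cPr P {ω | R₁ ω = true} {ω | X₁ ω = x₁ ∧ X₂ ω = x₂}
        = cPr P {ω | R₁ ω = true} {ω | X₂ ω = x₂})
    -- (P2)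
    (h₁ : α₁ → ℝ) (h₀ : ℝ)
    (hP2a : ∀ (x₁ : α₁) (x₂ : α₂),
      cPr P {ω | R₂ ω = true} {ω | X₁ ω = x₁ ∧ X₂ ω = x₂ ∧ R₁ ω = true} = h₁ x₁)
    (hP2b : ∀ (x₁ : α₁) (x₂ : α₂),
      cPr P {ω | R₂ ω = true} {ω | X₁ ω = x₁ ∧ X₂ ω = x₂ ∧ R₁ ω = false} = h₀)
    -- the functionals T₁, T₀ and W of the observed data law
    (T₁ T₀ W : α₂ → ℝ)
    (hT₁ : ∀ x₂, T₁ x₂ = ∑ x₁' : α₁,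
      cPr P {ω | X₂ ω = x₂} {ω | R₂ ω = true ∧ R₁ ω = true ∧ X₁ ω = x₁'}
        * Pr P {ω | R₁ ω = true ∧ X₁ ω = x₁'})
    (hT₀ : ∀ x₂, T₀ x₂ =
      cPr P {ω | X₂ ω = x₂} {ω | R₂ ω = true ∧ R₁ ω = false} * Pr P {ω | R₁ ω = false})
    (hW : ∀ x₂, W x₂ = T₁ x₂ / (T₁ x₂ + T₀ x₂)) :
    ∀ (x₁ : α₁) (x₂ : α₂),
      -- the identification formula for the target law
      (Pr P {ω | X₁ ω = x₁ ∧ X₂ ω = x₂}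
        = Pr P {ω | X₁ ω = x₁ ∧ X₂ ω = x₂ ∧ R₁ ω = true ∧ R₂ ω = true}
          / (cPr P {ω | R₂ ω = true} {ω | R₁ ω = true ∧ X₁ ω = x₁} * W x₂))
      -- moreover W(x₂) = P(R₁ = 1 | X₂ = x₂)
      ∧ W x₂ = cPr P {ω | R₁ ω = true} {ω | X₂ ω = x₂}
      -- every probability on the RHS equals the same expression with each Xₖ replaced by
      -- its proxy Lₖ (each Xₖ is conditioned on Rₖ = 1)
      ∧ Pr P {ω | X₁ ω = x₁ ∧ X₂ ω = x₂ ∧ R₁ ω = true ∧ R₂ ω = true}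
          = Pr P {ω | L₁ ω = some x₁ ∧ L₂ ω = some x₂ ∧ R₁ ω = true ∧ R₂ ω = true}
      ∧ cPr P {ω | R₂ ω = true} {ω | R₁ ω = true ∧ X₁ ω = x₁}
          = cPr P {ω | R₂ ω = true} {ω | R₁ ω = true ∧ L₁ ω = some x₁}
      ∧ (∀ x₁' : α₁,
          cPr P {ω | X₂ ω = x₂} {ω | R₂ ω = true ∧ R₁ ω = true ∧ X₁ ω = x₁'}
            = cPr P {ω | L₂ ω = some x₂} {ω | R₂ ω = true ∧ R₁ ω = true ∧ L₁ ω = some x₁'})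
      ∧ cPr P {ω | X₂ ω = x₂} {ω | R₂ ω = true ∧ R₁ ω = false}
          = cPr P {ω | L₂ ω = some x₂} {ω | R₂ ω = true ∧ R₁ ω = false}
      ∧ (∀ x₁' : α₁, Pr P {ω | R₁ ω = true ∧ X₁ ω = x₁'}
          = Pr P {ω | R₁ ω = true ∧ L₁ ω = some x₁'}) := by
  obtain ⟨y₁⟩ := ‹Nonempty α₁›
  obtain ⟨y₂⟩ := ‹Nonempty α₂›
  have hposX (x₁ x₂) : 0 < Pr P {ω | X₁ ω = x₁ ∧ X₂ ω = x₂} :=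
    Pr_pos_of_subset (hpos x₁ x₂ true true) fun ω h => ⟨h.1, h.2.1⟩
  have hposXR (x₁ x₂ r) : 0 < Pr P {ω | X₁ ω = x₁ ∧ X₂ ω = x₂ ∧ R₁ ω = r} :=
    Pr_pos_of_subset (hpos x₁ x₂ r true) fun ω h => ⟨h.1, h.2.1, h.2.2.1⟩
  have hposR₁X₁ (x₁) : 0 < Pr P {ω | R₁ ω = true ∧ X₁ ω = x₁} :=
    Pr_pos_of_subset (hpos x₁ y₂ true true) fun ω h => ⟨h.2.2.1, h.1⟩
  have hposR₁ : 0 < Pr P {ω | R₁ ω = false} :=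
    Pr_pos_of_subset (hpos y₁ y₂ false true) fun ω h => h.2.2.1
  have hh₁ (x₁) : h₁ x₁ ≠ 0 := by
    rw [← hP2a x₁ y₂]
    refine (div_pos (Pr_pos_of_subset (hpos x₁ y₂ true true) ?_) (hposXR x₁ y₂ true)).ne'
    exact fun ω h => ⟨h.2.2.2, h.1, h.2.1, h.2.2.1⟩
  have hh₀ : h₀ ≠ 0 := by
    rw [← hP2b y₁ y₂]
    refine (div_pos (Pr_pos_of_subset (hpos y₁ y₂ false true) ?_) (hposXR y₁ y₂ false)).ne'
    exact fun ω h => ⟨h.2.2.2, h.1, h.2.1, h.2.2.1⟩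
  have hE₁ (x₁ x₂) : Pr P ({ω | R₂ ω = true} ∩ ({ω | R₁ ω = true ∧ X₁ ω = x₁} ∩ {ω | X₂ ω = x₂}))
      = h₁ x₁ * Pr P ({ω | R₁ ω = true ∧ X₁ ω = x₁} ∩ {ω | X₂ ω = x₂}) := by
    have hset : {ω | R₁ ω = true ∧ X₁ ω = x₁} ∩ {ω | X₂ ω = x₂}
        = {ω | X₁ ω = x₁ ∧ X₂ ω = x₂ ∧ R₁ ω = true} := by
      ext ω; simp only [Set.mem_inter_iff, Set.mem_ofPred_eq]; tauto
    rw [hset]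
    exact Pr_inter_eq_mul_of_cPr_eq (hposXR x₁ x₂ true).ne' (hP2a x₁ x₂)
  have hE₁' (x₁) := Pr_inter_eq_mul_of_fiberwise hmX₂ (hE₁ x₁)
  have hE₀ (x₂) : Pr P ({ω | R₂ ω = true} ∩ ({ω | R₁ ω = false} ∩ {ω | X₂ ω = x₂}))
      = h₀ * Pr P ({ω | R₁ ω = false} ∩ {ω | X₂ ω = x₂}) := by
    refine Pr_inter_eq_mul_of_fiberwise hmX₁ fun x₁ => ?_
    have hset : {ω | R₁ ω = false} ∩ {ω | X₂ ω = x₂} ∩ {ω | X₁ ω = x₁}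
        = {ω | X₁ ω = x₁ ∧ X₂ ω = x₂ ∧ R₁ ω = false} := by
      ext ω; simp only [Set.mem_inter_iff, Set.mem_ofPred_eq]; tauto
    rw [hset]
    exact Pr_inter_eq_mul_of_cPr_eq (hposXR x₁ x₂ false).ne' (hP2b x₁ x₂)
  have hE₀' := Pr_inter_eq_mul_of_fiberwise hmX₂ hE₀
  have hT₁_eq (x₂) : T₁ x₂ = Pr P ({ω | X₂ ω = x₂} ∩ {ω | R₁ ω = true}) := by
    rw [hT₁, Pr_eq_sum_inter_fiber hmX₁]
    refine Finset.sum_congr rfl fun x₁ _ => ?_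
    refine (cPr_mul_Pr_eq_Pr_inter (hh₁ x₁) (hposR₁X₁ x₁).ne' (hE₁' x₁) (hE₁ x₁ x₂)).trans ?_
    congr 1
    ext ω; simp only [Set.mem_inter_iff, Set.mem_ofPred_eq]; tauto
  have hT₀_eq (x₂) : T₀ x₂ = Pr P ({ω | X₂ ω = x₂} ∩ {ω | R₁ ω = false}) := by
    rw [hT₀, Set.inter_comm {ω | X₂ ω = x₂}]
    exact cPr_mul_Pr_eq_Pr_inter hh₀ hposR₁.ne' hE₀' (hE₀ x₂)
  have hW_eq (x₂) : W x₂ = cPr P {ω | R₁ ω = true} {ω | X₂ ω = x₂} := by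
    rw [hW, hT₁_eq, hT₀_eq, cPr, Pr_eq_sum_inter_fiber hmR₁ {ω | X₂ ω = x₂}, Fintype.sum_bool,
      Set.inter_comm {ω | R₁ ω = true}]
  have hL₁_iff (ω x) : L₁ ω = some x ↔ R₁ ω = true ∧ X₁ ω = x := by
    rw [hL₁]; split_ifs with h <;> simp [h]
  have hL₂_iff (ω x) : L₂ ω = some x ↔ R₂ ω = true ∧ X₂ ω = x := by
    rw [hL₂]; split_ifs with h <;> simp [h]
  have hR₁L₁ (x₁) : {ω | R₁ ω = true ∧ L₁ ω = some x₁} = {ω | R₁ ω = true ∧ X₁ ω = x₁} := by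
    ext ω; simp only [hL₁_iff, Set.mem_ofPred_eq]; tauto
  intro x₁ x₂
  refine ⟨?_, hW_eq x₂, ?_, ?_, fun x₁' => ?_, ?_, fun x₁' => ?_⟩
  · have hcPr : cPr P {ω | R₂ ω = true} {ω | R₁ ω = true ∧ X₁ ω = x₁} = h₁ x₁ :=
      (div_eq_iff (hposR₁X₁ x₁).ne').2 (hE₁' x₁)
    have hjoint : Pr P {ω | X₁ ω = x₁ ∧ X₂ ω = x₂ ∧ R₁ ω = true ∧ R₂ ω = true}
        = h₁ x₁ * Pr P {ω | X₁ ω = x₁ ∧ X₂ ω = x₂ ∧ R₁ ω = true} := by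
      rw [← Pr_inter_eq_mul_of_cPr_eq (hposXR x₁ x₂ true).ne' (hP2a x₁ x₂)]
      congr 1
      ext ω; simp only [Set.mem_inter_iff, Set.mem_ofPred_eq]; tauto
    have hset : {ω | R₁ ω = true} ∩ {ω | X₁ ω = x₁ ∧ X₂ ω = x₂}
        = {ω | X₁ ω = x₁ ∧ X₂ ω = x₂ ∧ R₁ ω = true} := by
      ext ω; simp only [Set.mem_inter_iff, Set.mem_ofPred_eq]; tauto
    rw [hcPr, hW_eq, ← hP1 x₁ x₂, cPr, hset, hjoint]
    have := hh₁ x₁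
    have := (hposX x₁ x₂).ne'
    have := (hposXR x₁ x₂ true).ne'
    field_simp
  · congr 1
    ext ω; simp only [hL₁_iff, hL₂_iff, Set.mem_ofPred_eq]; tauto
  · rw [hR₁L₁]
  · rw [cPr, cPr]
    congr 2 <;>
      (ext ω; simp only [hL₁_iff, hL₂_iff, Set.mem_inter_iff, Set.mem_ofPred_eq]; tauto)
  · rw [cPr, cPr]
    congr 2
    ext ω; simp only [hL₂_iff, Set.mem_inter_iff, Set.mem_ofPred_eq]; tauto
  · rw [hR₁L₁]
end

section
/- Target-law identification in the K-variable block-parallel MNAR model: let X = (X_1,…,X_K) be full-data variables with missingness indicators R = (R_1,…,R_K) ∈ {0,1}^K, with strictly positive joint law on the finite product state space. Assume that for every k and all values x and r_{−k}: P(R_k = 1 | X = x, R_{−k} = r_{−k}) = P(R_k = 1 | X_{−k} = x_{−k}), where the subscript −k denotes all coordinates other than k. Then for every x: P(X = x) = P(X = x, R = 1) / ∏_{k=1}^K P(R_k = 1 | X_{−k} = x_{−k}, R_{−k} = 1). Since each factor on the right conditions every X_j (j ≠ k) on R_j = 1, it is unchanged when each X_j is replaced by its proxy L_j, so the right-hand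 side is a functional of the observed-data law of (R, L). -/
open MeasureTheory

lemma Pr_mono {Ω : Type*} [MeasurableSpace Ω] (P : Measure Ω) [IsFiniteMeasure P] {A B : Set Ω}
    (h : A ⊆ B) : Pr P A ≤ Pr P B :=
  measureReal_mono h

lemma Pr_inter_eq_cPr_mul {Ω : Type*} [MeasurableSpace Ω] (P : Measure Ω) [IsFiniteMeasure P]
    (A B : Set Ω) : Pr P (A ∩ B) = cPr P A B * Pr P B := by
  rcases eq_or_ne (Pr P B) 0 with h | h
  · rw [h, mul_zero]
    exact le_antisymm (h ▸ Pr_mono P Set.inter_subset_right) ENNReal.toReal_nonneg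
  · exact (div_mul_cancel₀ _ h).symm

/-- Law of total probability over the fibers of a finitely valued function. -/
lemma Pr_eq_sum_fibers {Ω ι : Type*} [MeasurableSpace Ω] [Fintype ι] (P : Measure Ω)
    [IsFiniteMeasure P] (f : Ω → ι) (hf : ∀ i, MeasurableSet {ω | f ω = i}) (B : Set Ω) :
    Pr P B = ∑ i, Pr P (B ∩ {ω | f ω = i}) := by
  have h := sum_measure_preimage_singleton (μ := P.restrict B) (f := f) Finset.univ
    (fun i _ => hf i)
  simp only [Finset.coe_univ, Set.preimage_univ, Measure.restrict_apply_univ] at h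
  unfold Pr
  rw [← ENNReal.toReal_sum (fun i _ => measure_ne_top P _), ← h]
  congr 1
  refine Finset.sum_congr rfl fun i _ => ?_
  rw [Set.inter_comm]
  exact Measure.restrict_apply (hf i)

/-- If `A` has conditional probability `c` on every piece of a finite partition of `B`,
then it has conditional probability `c` on `B`. -/
lemma Pr_inter_eq_mul_of_fibers {Ω ι : Type*} [MeasurableSpace Ω] [Fintype ι] (P : Measure Ω)
    [IsFiniteMeasure P] (f : Ω → ι) (hf : ∀ i, MeasurableSet {ω | f ω = i}) (A B : Set Ω) (c : ℝ)
    (h : ∀ i, Pr P (A ∩ (B ∩ {ω | f ω = i})) = c * Pr P (B ∩ {ω | f ω = i})) :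
    Pr P (A ∩ B) = c * Pr P B := by
  rw [Pr_eq_sum_fibers P f hf (A ∩ B), Pr_eq_sum_fibers P f hf B, Finset.mul_sum]
  exact Finset.sum_congr rfl fun i _ => by rw [Set.inter_assoc, h i]

/-- target-law identification in the K-variable block-parallel MNAR model. -/
theorem block_parallel_id
    {Ω : Type*} [MeasurableSpace Ω] (P : Measure Ω) [IsProbabilityMeasure P]
    {K : ℕ} {α : Fin K → Type*} [∀ k, Fintype (α k)] [∀ k, Nonempty (α k)]
    (X : ∀ k, Ω → α k) (R : Fin K → Ω → Bool) (L : ∀ k, Ω → Option (α k))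
    (hmX : ∀ (k : Fin K) (a : α k), MeasurableSet {ω | X k ω = a})
    (hmR : ∀ (k : Fin K) (b : Bool), MeasurableSet {ω | R k ω = b})
    (hL : ∀ (k : Fin K) (ω : Ω), L k ω = if R k ω then some (X k ω) else none)
    -- strict positivity of the joint law
    (hpos : ∀ (x : ∀ k, α k) (r : Fin K → Bool),
      0 < Pr P {ω | (∀ k, X k ω = x k) ∧ (∀ k, R k ω = r k)})
    -- block-parallel restriction: P(R_k = 1 | X = x, R_{-k} = r_{-k}) = P(R_k = 1 | X_{-k} = x_{-k})
    (hbp : ∀ (k : Fin K) (x : ∀ j, α j) (r : Fin K → Bool),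
      cPr P {ω | R k ω = true}
        {ω | (∀ j, X j ω = x j) ∧ (∀ j, j ≠ k → R j ω = r j)}
        = cPr P {ω | R k ω = true} {ω | ∀ j, j ≠ k → X j ω = x j}) :
    ∀ x : (∀ k, α k),
      -- identification of the target law
      (Pr P {ω | ∀ k, X k ω = x k}
        = Pr P {ω | (∀ k, X k ω = x k) ∧ (∀ k, R k ω = true)}
          / ∏ k, cPr P {ω | R k ω = true}
              {ω | (∀ j, j ≠ k → X j ω = x j) ∧ (∀ j, j ≠ k → R j ω = true)})
      -- each factor is unchanged when the X's are replaced by their proxies,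
      -- hence is a functional of the observed-data law of (R, L)
      ∧ (∀ k : Fin K,
          cPr P {ω | R k ω = true}
            {ω | (∀ j, j ≠ k → X j ω = x j) ∧ (∀ j, j ≠ k → R j ω = true)}
          = cPr P {ω | R k ω = true}
              {ω | (∀ j, j ≠ k → L j ω = some (x j)) ∧ (∀ j, j ≠ k → R j ω = true)}) := by
  classical
  intro x
  set p : Fin K → ℝ := fun k => cPr P {ω | R k ω = true} {ω | ∀ j, j ≠ k → X j ω = x j} with hp
  have factor : ∀ k : Fin K, cPr P {ω | R k ω = true}
      {ω | (∀ j, j ≠ k → X j ω = x j) ∧ (∀ j, j ≠ k → R j ω = true)} = p k := by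
    intro k
    refine (div_eq_iff ?_).2 ?_
    · refine ((hpos x fun _ => true).trans_le (Pr_mono P ?_)).ne'
      exact fun ω hω => ⟨fun j _ => hω.1 j, fun j _ => hω.2 j⟩
    · refine Pr_inter_eq_mul_of_fibers P (X k) (hmX k) _ _ _ fun a => ?_
      have hfib : {ω | (∀ j, j ≠ k → X j ω = x j) ∧ (∀ j, j ≠ k → R j ω = true)} ∩
          {ω | X k ω = a} =
          {ω | (∀ j, X j ω = Function.update x k a j) ∧ (∀ j, j ≠ k → R j ω = true)} := by
        ext ω
        simp only [Set.mem_inter_iff, Set.mem_ofPred_eq, Function.forall_update_iff x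
          (fun j b => X j ω = b)]
        tauto
      have hx : {ω | ∀ j, j ≠ k → X j ω = Function.update x k a j} =
          {ω | ∀ j, j ≠ k → X j ω = x j} := by
        ext ω
        exact forall₂_congr fun j hj => by rw [Function.update_of_ne hj]
      rw [hfib, Pr_inter_eq_cPr_mul, hbp k (Function.update x k a) (fun _ => true), hx]
  have joint : ∀ S : Finset (Fin K),
      Pr P {ω | (∀ k, X k ω = x k) ∧ (∀ k ∈ S, R k ω = true)}
        = (∏ k ∈ S, p k) * Pr P {ω | ∀ k, X k ω = x k} := by
    intro S
    induction S using Finset.induction_on with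
    | empty => simp
    | insert k S hk ih =>
      rw [Finset.prod_insert hk, mul_assoc, ← ih]
      have hins : {ω | (∀ j, X j ω = x j) ∧ (∀ j ∈ insert k S, R j ω = true)} =
          {ω | R k ω = true} ∩ {ω | (∀ j, X j ω = x j) ∧ (∀ j ∈ S, R j ω = true)} := by
        ext ω
        simp only [Finset.forall_mem_insert, Set.mem_inter_iff, Set.mem_ofPred_eq]
        tauto
      rw [hins]
      refine Pr_inter_eq_mul_of_fibers P (fun ω (j : {j // j ≠ k}) => R j ω) (fun r => ?_)
        _ _ _ fun r => ?_
      · simp only [funext_iff, Set.ofPred_forall]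
        exact MeasurableSet.iInter fun j => hmR j (r j)
      · by_cases hr : ∀ j : {j // j ≠ k}, (j : Fin K) ∈ S → r j = true
        · have hfib : {ω | (∀ j, X j ω = x j) ∧ (∀ j ∈ S, R j ω = true)} ∩
              {ω | (fun j : {j // j ≠ k} => R j ω) = r} =
              {ω | (∀ j, X j ω = x j) ∧
                (∀ j, j ≠ k → R j ω = if h : j ≠ k then r ⟨j, h⟩ else true)} := by
            ext ω
            simp only [Set.mem_inter_iff, Set.mem_ofPred_eq, funext_iff, Subtype.forall]
            constructor
            · rintro ⟨⟨h₁, -⟩, h₂⟩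
              exact ⟨h₁, fun j hj => by rw [dif_pos hj, h₂ j hj]⟩
            · rintro ⟨h₁, h₂⟩
              have h₃ : ∀ j (hj : j ≠ k), R j ω = r ⟨j, hj⟩ := fun j hj => by
                rw [h₂ j hj, dif_pos hj]
              refine ⟨⟨h₁, fun j hj => ?_⟩, h₃⟩
              have hjk : j ≠ k := fun h => hk (h ▸ hj)
              rw [h₃ j hjk, hr ⟨j, hjk⟩ hj]
          rw [hfib, Pr_inter_eq_cPr_mul, hbp k x]
        · have hfib : {ω | (∀ j, X j ω = x j) ∧ (∀ j ∈ S, R j ω = true)} ∩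
              {ω | (fun j : {j // j ≠ k} => R j ω) = r} = ∅ := by
            refine Set.eq_empty_of_forall_notMem fun ω hω => hr fun j hj => ?_
            rw [← congrFun hω.2 j]
            exact hω.1.2 j hj
          simp [hfib, Pr]
  refine ⟨?_, fun k => ?_⟩
  · have h := joint Finset.univ
    simp only [Finset.mem_univ, true_imp_iff] at h
    have hne := (hpos x fun _ => true).ne'
    rw [h] at hne ⊢
    rw [Finset.prod_congr rfl fun k _ => factor k, mul_div_cancel_left₀ _ (left_ne_zero_of_mul hne)]
  · congr 1
    ext ω
    refine and_congr_left fun hR => forall₂_congr fun j hj => ?_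
    rw [hL, hR j hj, if_pos rfl, Option.some_inj]
end

section
/- Target-law identification requiring combined sequential and parallel interventions (the three-variable model of Fig. 4(a)): let (X_1, X_2, X_3, R_1, R_2, R_3) have a strictly positive joint probability mass function on a finite product space that factorizes as p(x_1,x_2,x_3,r_1,r_2,r_3) = q_1(x_1)·q_2(x_2|x_1)·q_3(x_3|x_1,x_2)·π_1(r_1|x_2,x_3)·π_2(r_2|r_1,x_3)·π_3(r_3|r_1,x_2), where each factor is a probability mass function in its first argument. Define a_2(r_1, x_3) := P(R_2 = 1 | R_1 = r_1, R_3 = 1, X_3 = x_3) and a_3(r_1, x_2) := P(R_3 = 1 | R_1 = r_1, R_2 = 1, X_2 = x_2). Then: (i) π_2(1|r_1,x_3) = a_2(r_1,x_3) and π_3(1|r_1,x_2) = a_3(r_1,x_2) for all r_1, x_2, x_3; (ii) π_1(1|x_2,x_3) = [ P(X_2=x_2, X_3=x_3, R_1=1, R_2=1, R_3=1)/(a_2(1,x_3)·a_3(1,x_2)) ] / [ Σ_{r_1∈{0,1}} P(X_2=x_2, X_3=x_3, R_1=r_1, R_2=1, R_3=1)/(a_2(r_1,x_3)·a_3(r_1,x_2))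 ]; and (iii) the target law is P(X_1=x_1, X_2=x_2, X_3=x_3) = P(X_1=x_1, X_2=x_2, X_3=x_3, R_1=1, R_2=1, R_3=1) / ( π_1(1|x_2,x_3) · a_2(1,x_3) · a_3(1,x_2) ). Every probability on the right-hand sides conditions each X_k on the event R_k = 1 and is therefore a functional of the observed-data law. -/
/-- target-law identification requiring combined sequential and parallel
interventions (the three-variable model of Fig. 4(a)).  The joint pmf factorizes as
`p(x₁,x₂,x₃,r₁,r₂,r₃) = q₁(x₁) q₂(x₂|x₁) q₃(x₃|x₁,x₂) w₁(r₁|x₂,x₃) w₂(r₂|r₁,x₃) w₃(r₃|r₁,x₂)`.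
With `a₂(r₁,x₃) = P(R₂=1 | R₁=r₁, R₃=1, X₃=x₃)` and `a₃(r₁,x₂) = P(R₃=1 | R₁=r₁, R₂=1, X₂=x₂)`
(written below as explicit ratios of sums of the joint pmf), the propensity scores and the
target law are identified. -/
theorem seq_parallel_three_var_id
    {α₁ α₂ α₃ : Type*} [Fintype α₁] [Nonempty α₁] [Fintype α₂] [Nonempty α₂]
    [Fintype α₃] [Nonempty α₃]
    (q₁ : α₁ → ℝ) (q₂ : α₂ → α₁ → ℝ) (q₃ : α₃ → α₁ → α₂ → ℝ)
    (w₁ : Bool → α₂ → α₃ → ℝ) (w₂ : Bool → Bool → α₃ → ℝ) (w₃ : Bool → Bool → α₂ → ℝ)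
    -- each factor is a probability mass function in its first argument
    (hq₁nn : ∀ x₁, 0 ≤ q₁ x₁) (hq₁s : ∑ x₁, q₁ x₁ = 1)
    (hq₂nn : ∀ x₂ x₁, 0 ≤ q₂ x₂ x₁) (hq₂s : ∀ x₁, ∑ x₂, q₂ x₂ x₁ = 1)
    (hq₃nn : ∀ x₃ x₁ x₂, 0 ≤ q₃ x₃ x₁ x₂) (hq₃s : ∀ x₁ x₂, ∑ x₃, q₃ x₃ x₁ x₂ = 1)
    (hw₁nn : ∀ r₁ x₂ x₃, 0 ≤ w₁ r₁ x₂ x₃) (hw₁s : ∀ x₂ x₃, ∑ r₁, w₁ r₁ x₂ x₃ = 1)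
    (hw₂nn : ∀ r₂ r₁ x₃, 0 ≤ w₂ r₂ r₁ x₃) (hw₂s : ∀ r₁ x₃, ∑ r₂, w₂ r₂ r₁ x₃ = 1)
    (hw₃nn : ∀ r₃ r₁ x₂, 0 ≤ w₃ r₃ r₁ x₂) (hw₃s : ∀ r₁ x₂, ∑ r₃, w₃ r₃ r₁ x₂ = 1)
    -- the joint pmf and its factorization
    (p : α₁ → α₂ → α₃ → Bool → Bool → Bool → ℝ)
    (hp : ∀ x₁ x₂ x₃ r₁ r₂ r₃,
      p x₁ x₂ x₃ r₁ r₂ r₃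
        = q₁ x₁ * q₂ x₂ x₁ * q₃ x₃ x₁ x₂ * w₁ r₁ x₂ x₃ * w₂ r₂ r₁ x₃ * w₃ r₃ r₁ x₂)
    -- strict positivity of the joint pmf
    (hppos : ∀ x₁ x₂ x₃ r₁ r₂ r₃, 0 < p x₁ x₂ x₃ r₁ r₂ r₃)
    -- a₂(r₁, x₃) := P(R₂ = 1 | R₁ = r₁, R₃ = 1, X₃ = x₃)
    (a₂ : Bool → α₃ → ℝ)
    (ha₂ : ∀ r₁ x₃, a₂ r₁ x₃
      = (∑ x₁, ∑ x₂, p x₁ x₂ x₃ r₁ true true)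
        / (∑ x₁, ∑ x₂, ∑ r₂, p x₁ x₂ x₃ r₁ r₂ true))
    -- a₃(r₁, x₂) := P(R₃ = 1 | R₁ = r₁, R₂ = 1, X₂ = x₂)
    (a₃ : Bool → α₂ → ℝ)
    (ha₃ : ∀ r₁ x₂, a₃ r₁ x₂
      = (∑ x₁, ∑ x₃, p x₁ x₂ x₃ r₁ true true)
        / (∑ x₁, ∑ x₃, ∑ r₃, p x₁ x₂ x₃ r₁ true r₃)) :
    -- (i) the propensity scores of R₂ and R₃ are identified
    (∀ r₁ x₃, w₂ true r₁ x₃ = a₂ r₁ x₃) ∧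
    (∀ r₁ x₂, w₃ true r₁ x₂ = a₃ r₁ x₂) ∧
    -- (ii) the propensity score of R₁ is identified
    (∀ x₂ x₃, w₁ true x₂ x₃
      = ((∑ x₁, p x₁ x₂ x₃ true true true) / (a₂ true x₃ * a₃ true x₂))
        / (∑ r₁, (∑ x₁, p x₁ x₂ x₃ r₁ true true) / (a₂ r₁ x₃ * a₃ r₁ x₂))) ∧
    -- (iii) the target law is identified
    (∀ x₁ x₂ x₃,
      (∑ r₁, ∑ r₂, ∑ r₃, p x₁ x₂ x₃ r₁ r₂ r₃)
        = p x₁ x₂ x₃ true true true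
          / (w₁ true x₂ x₃ * a₂ true x₃ * a₃ true x₂)) := by
  inhabit α₁
  inhabit α₂
  inhabit α₃
  have factors_ne (x₁ x₂ x₃ r₁ r₂ r₃) : q₁ x₁ * q₂ x₂ x₁ * q₃ x₃ x₁ x₂ ≠ 0 ∧
      w₁ r₁ x₂ x₃ ≠ 0 ∧ w₂ r₂ r₁ x₃ ≠ 0 ∧ w₃ r₃ r₁ x₂ ≠ 0 := by
    have h := (hppos x₁ x₂ x₃ r₁ r₂ r₃).ne'
    rw [hp] at h
    exact ⟨left_ne_zero_of_mul (left_ne_zero_of_mul (left_ne_zero_of_mul h)),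
      right_ne_zero_of_mul (left_ne_zero_of_mul (left_ne_zero_of_mul h)),
      right_ne_zero_of_mul (left_ne_zero_of_mul h), right_ne_zero_of_mul h⟩
  have w₁_ne (r₁ x₂ x₃) : w₁ r₁ x₂ x₃ ≠ 0 :=
    (factors_ne default x₂ x₃ r₁ true true).2.1
  have w₂_ne (r₁ x₃) : w₂ true r₁ x₃ ≠ 0 :=
    (factors_ne default default x₃ r₁ true true).2.2.1
  have w₃_ne (r₁ x₂) : w₃ true r₁ x₂ ≠ 0 :=
    (factors_ne default x₂ default r₁ true true).2.2.2
  have hw₂_eq (r₁ x₃) : w₂ true r₁ x₃ = a₂ r₁ x₃ := by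
    have hpos : 0 < ∑ x₁, ∑ x₂, ∑ r₂, p x₁ x₂ x₃ r₁ r₂ true :=
      Finset.sum_pos (fun _ _ => Finset.sum_pos (fun _ _ => Finset.sum_pos
        (fun _ _ => hppos _ _ _ _ _ _) Finset.univ_nonempty) Finset.univ_nonempty)
        Finset.univ_nonempty
    rw [ha₂, eq_div_iff hpos.ne']
    simp only [Finset.mul_sum]
    refine Finset.sum_congr rfl fun x₁ _ => Finset.sum_congr rfl fun x₂ _ => ?_
    simp only [hp, ← Finset.mul_sum, ← Finset.sum_mul, hw₂s]
    ring
  have hw₃_eq (r₁ x₂) : w₃ true r₁ x₂ = a₃ r₁ x₂ := by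
    have hpos : 0 < ∑ x₁, ∑ x₃, ∑ r₃, p x₁ x₂ x₃ r₁ true r₃ :=
      Finset.sum_pos (fun _ _ => Finset.sum_pos (fun _ _ => Finset.sum_pos
        (fun _ _ => hppos _ _ _ _ _ _) Finset.univ_nonempty) Finset.univ_nonempty)
        Finset.univ_nonempty
    rw [ha₃, eq_div_iff hpos.ne']
    simp only [Finset.mul_sum]
    refine Finset.sum_congr rfl fun x₁ _ => Finset.sum_congr rfl fun x₃ _ => ?_
    simp only [hp, ← Finset.mul_sum, hw₃s]
    ring
  refine ⟨hw₂_eq, hw₃_eq, fun x₂ x₃ => ?_, fun x₁ x₂ x₃ => ?_⟩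
  · have reweighted (r₁) : (∑ x₁, p x₁ x₂ x₃ r₁ true true) / (a₂ r₁ x₃ * a₃ r₁ x₂)
        = (∑ x₁, q₁ x₁ * q₂ x₂ x₁ * q₃ x₃ x₁ x₂) * w₁ r₁ x₂ x₃ := by
      rw [← hw₂_eq, ← hw₃_eq, div_eq_iff (mul_ne_zero (w₂_ne _ _) (w₃_ne _ _))]
      simp only [hp, ← Finset.sum_mul]
      ring
    have marginal_ne : (∑ x₁, q₁ x₁ * q₂ x₂ x₁ * q₃ x₃ x₁ x₂) ≠ 0 :=
      (Finset.sum_pos (fun x₁ _ => lt_of_le_of_ne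
        (mul_nonneg (mul_nonneg (hq₁nn _) (hq₂nn _ _)) (hq₃nn _ _ _))
        (factors_ne x₁ x₂ x₃ true true true).1.symm) Finset.univ_nonempty).ne'
    simp only [reweighted, ← Finset.mul_sum, hw₁s]
    rw [mul_one, mul_div_cancel_left₀ _ marginal_ne]
  · rw [← hw₂_eq, ← hw₃_eq,
      eq_div_iff (mul_ne_zero (mul_ne_zero (w₁_ne _ _ _) (w₂_ne _ _)) (w₃_ne _ _))]
    simp only [hp, ← Finset.mul_sum, hw₃s, hw₂s, hw₁s, mul_one]
    ring
end

section
/- Target-law identification via a pseudo-propensity score (the three-variable model of Fig. 5(a)): let (X_1, X_2, X_3, R_1, R_2, R_3) have a strictly positive joint probability mass function on a finite product space that factorizes as p(x_1,x_2,x_3,r_1,r_2,r_3) = q_1(x_1)·q_2(x_2)·q_3(x_3|x_2)·π_1(r_1|x_2)·π_2(r_2|r_1,x_1,x_3)·π_3(r_3|r_1,x_2), where each factor is a probability mass function in its first argument. Define b_2(r_1, x_3) := P(R_2 = 1 | R_1 = r_1, R_3 = 1, X_3 = x_3), a_3(r_1, x_2) := P(R_3 = 1 | R_1 = r_1, R_2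 = 1, X_2 = x_2), and a_2(x_1, x_3) := P(R_2 = 1 | R_1 = 1, R_3 = 1, X_1 = x_1, X_3 = x_3). Then: (i) a_3(r_1,x_2) = π_3(1|r_1,x_2), a_2(x_1,x_3) = π_2(1|1,x_1,x_3), and b_2(r_1,x_3) = Σ_{x_1} q_1(x_1)·π_2(1|r_1,x_1,x_3); (ii) π_1(1|x_2) = [ Σ_{x_3} P(X_2=x_2, X_3=x_3, R_1=1, R_2=1, R_3=1)/(b_2(1,x_3)·a_3(1,x_2)) ] / [ Σ_{x_3} Σ_{r_1∈{0,1}} P(X_2=x_2, X_3=x_3, R_1=r_1, R_2=1, R_3=1)/(b_2(r_1,x_3)·a_3(r_1,x_2)) ]; and (iii) the target law is P(X_1=x_1, X_2=x_2, X_3=x_3) = P(X_1=x_1, X_2=x_2, X_3=x_3, R_1=1, R_2=1, R_3=1) / ( π_1(1|x_2) · a_2(x_1,x_3) · a_3(1,x_2) ). Every probability appearing in (ii) and (iii) conditions each X_k on the event R_k = 1 and is therefore a functional of the observed-data law. -/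
/-- target-law identification via a pseudo-propensity score (the
three-variable model of Fig. 5(a)).  The joint pmf factorizes as
`p(x₁,x₂,x₃,r₁,r₂,r₃) = q₁(x₁) q₂(x₂) q₃(x₃|x₂) w₁(r₁|x₂) w₂(r₂|r₁,x₁,x₃) w₃(r₃|r₁,x₂)`.
With `b₂(r₁,x₃) = P(R₂=1 | R₁=r₁, R₃=1, X₃=x₃)`, `a₃(r₁,x₂) = P(R₃=1 | R₁=r₁, R₂=1, X₂=x₂)`
and `a₂(x₁,x₃) = P(R₂=1 | R₁=1, R₃=1, X₁=x₁, X₃=x₃)` (written as explicit ratios of sums of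
the joint pmf), the propensity scores and the target law are identified. -/
theorem pseudo_propensity_three_var_id
    {α₁ α₂ α₃ : Type*} [Fintype α₁] [Nonempty α₁] [Fintype α₂] [Nonempty α₂]
    [Fintype α₃] [Nonempty α₃]
    (q₁ : α₁ → ℝ) (q₂ : α₂ → ℝ) (q₃ : α₃ → α₂ → ℝ)
    (w₁ : Bool → α₂ → ℝ) (w₂ : Bool → Bool → α₁ → α₃ → ℝ) (w₃ : Bool → Bool → α₂ → ℝ)
    -- each factor is a probability mass function in its first argument
    (hq₁nn : ∀ x₁, 0 ≤ q₁ x₁) (hq₁s : ∑ x₁, q₁ x₁ = 1)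
    (hq₂nn : ∀ x₂, 0 ≤ q₂ x₂) (hq₂s : ∑ x₂, q₂ x₂ = 1)
    (hq₃nn : ∀ x₃ x₂, 0 ≤ q₃ x₃ x₂) (hq₃s : ∀ x₂, ∑ x₃, q₃ x₃ x₂ = 1)
    (hw₁nn : ∀ r₁ x₂, 0 ≤ w₁ r₁ x₂) (hw₁s : ∀ x₂, ∑ r₁, w₁ r₁ x₂ = 1)
    (hw₂nn : ∀ r₂ r₁ x₁ x₃, 0 ≤ w₂ r₂ r₁ x₁ x₃) (hw₂s : ∀ r₁ x₁ x₃, ∑ r₂, w₂ r₂ r₁ x₁ x₃ = 1)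
    (hw₃nn : ∀ r₃ r₁ x₂, 0 ≤ w₃ r₃ r₁ x₂) (hw₃s : ∀ r₁ x₂, ∑ r₃, w₃ r₃ r₁ x₂ = 1)
    -- the joint pmf and its factorization
    (p : α₁ → α₂ → α₃ → Bool → Bool → Bool → ℝ)
    (hp : ∀ x₁ x₂ x₃ r₁ r₂ r₃,
      p x₁ x₂ x₃ r₁ r₂ r₃
        = q₁ x₁ * q₂ x₂ * q₃ x₃ x₂ * w₁ r₁ x₂ * w₂ r₂ r₁ x₁ x₃ * w₃ r₃ r₁ x₂)
    -- strict positivity of the joint pmf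
    (hppos : ∀ x₁ x₂ x₃ r₁ r₂ r₃, 0 < p x₁ x₂ x₃ r₁ r₂ r₃)
    -- b₂(r₁, x₃) := P(R₂ = 1 | R₁ = r₁, R₃ = 1, X₃ = x₃)  (the pseudo-propensity score)
    (b₂ : Bool → α₃ → ℝ)
    (hb₂ : ∀ r₁ x₃, b₂ r₁ x₃
      = (∑ x₁, ∑ x₂, p x₁ x₂ x₃ r₁ true true)
        / (∑ x₁, ∑ x₂, ∑ r₂, p x₁ x₂ x₃ r₁ r₂ true))
    -- a₃(r₁, x₂) := P(R₃ = 1 | R₁ = r₁, R₂ = 1, X₂ = x₂)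
    (a₃ : Bool → α₂ → ℝ)
    (ha₃ : ∀ r₁ x₂, a₃ r₁ x₂
      = (∑ x₁, ∑ x₃, p x₁ x₂ x₃ r₁ true true)
        / (∑ x₁, ∑ x₃, ∑ r₃, p x₁ x₂ x₃ r₁ true r₃))
    -- a₂(x₁, x₃) := P(R₂ = 1 | R₁ = 1, R₃ = 1, X₁ = x₁, X₃ = x₃)
    (a₂ : α₁ → α₃ → ℝ)
    (ha₂ : ∀ x₁ x₃, a₂ x₁ x₃
      = (∑ x₂, p x₁ x₂ x₃ true true true)
        / (∑ x₂, ∑ r₂, p x₁ x₂ x₃ true r₂ true)) :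
    -- (i)
    (∀ r₁ x₂, a₃ r₁ x₂ = w₃ true r₁ x₂) ∧
    (∀ x₁ x₃, a₂ x₁ x₃ = w₂ true true x₁ x₃) ∧
    (∀ r₁ x₃, b₂ r₁ x₃ = ∑ x₁, q₁ x₁ * w₂ true r₁ x₁ x₃) ∧
    -- (ii) the propensity score of R₁ is identified
    (∀ x₂, w₁ true x₂
      = (∑ x₃, (∑ x₁, p x₁ x₂ x₃ true true true) / (b₂ true x₃ * a₃ true x₂))
        / (∑ x₃, ∑ r₁, (∑ x₁, p x₁ x₂ x₃ r₁ true true) / (b₂ r₁ x₃ * a₃ r₁ x₂))) ∧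
    -- (iii) the target law is identified
    (∀ x₁ x₂ x₃,
      (∑ r₁, ∑ r₂, ∑ r₃, p x₁ x₂ x₃ r₁ r₂ r₃)
        = p x₁ x₂ x₃ true true true
          / (w₁ true x₂ * a₂ x₁ x₃ * a₃ true x₂)) := by
  have factors_pos : ∀ x₁ x₂ x₃ r₁ r₂ r₃, 0 < q₁ x₁ ∧ 0 < q₂ x₂ ∧ 0 < w₁ r₁ x₂ ∧
      0 < w₂ r₂ r₁ x₁ x₃ ∧ 0 < w₃ r₃ r₁ x₂ := by
    intro x₁ x₂ x₃ r₁ r₂ r₃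
    have h := (hppos x₁ x₂ x₃ r₁ r₂ r₃).ne'
    simp only [hp, ne_eq, mul_eq_zero, not_or] at h
    obtain ⟨⟨⟨⟨⟨h₁, h₂⟩, -⟩, h₄⟩, h₅⟩, h₆⟩ := h
    exact ⟨(hq₁nn _).lt_of_ne' h₁, (hq₂nn _).lt_of_ne' h₂, (hw₁nn _ _).lt_of_ne' h₄,
      (hw₂nn _ _ _ _).lt_of_ne' h₅, (hw₃nn _ _ _).lt_of_ne' h₆⟩
  obtain ⟨y₁⟩ := ‹Nonempty α₁›
  obtain ⟨y₂⟩ := ‹Nonempty α₂›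
  obtain ⟨y₃⟩ := ‹Nonempty α₃›
  have sum_r₂ : ∀ x₁ x₂ x₃ r₁ r₃, ∑ r₂, p x₁ x₂ x₃ r₁ r₂ r₃
      = q₁ x₁ * q₂ x₂ * q₃ x₃ x₂ * w₁ r₁ x₂ * w₃ r₃ r₁ x₂ := by
    intro x₁ x₂ x₃ r₁ r₃
    simp only [hp]
    rw [← Finset.sum_mul, ← Finset.mul_sum, hw₂s, mul_one]
  have sum_r₃ : ∀ x₁ x₂ x₃ r₁ r₂, ∑ r₃, p x₁ x₂ x₃ r₁ r₂ r₃
      = q₁ x₁ * q₂ x₂ * q₃ x₃ x₂ * w₁ r₁ x₂ * w₂ r₂ r₁ x₁ x₃ := by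
    intro x₁ x₂ x₃ r₁ r₂
    simp only [hp]
    rw [← Finset.mul_sum, hw₃s, mul_one]
  have ha₃_eq : ∀ r₁ x₂, a₃ r₁ x₂ = w₃ true r₁ x₂ := by
    intro r₁ x₂
    have hpos : 0 < ∑ x₁, ∑ x₃, ∑ r₃, p x₁ x₂ x₃ r₁ true r₃ :=
      Finset.sum_pos (fun x₁ _ => Finset.sum_pos (fun x₃ _ => Finset.sum_pos
        (fun r₃ _ => hppos x₁ x₂ x₃ r₁ true r₃) ⟨true, Finset.mem_univ _⟩)
        ⟨y₃, Finset.mem_univ _⟩) ⟨y₁, Finset.mem_univ _⟩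
    rw [ha₃, div_eq_iff hpos.ne']
    simp only [sum_r₃]
    simp only [hp, Finset.mul_sum]
    exact Finset.sum_congr rfl fun _ _ => Finset.sum_congr rfl fun _ _ => by ring
  have ha₂_eq : ∀ x₁ x₃, a₂ x₁ x₃ = w₂ true true x₁ x₃ := by
    intro x₁ x₃
    have hpos : 0 < ∑ x₂, ∑ r₂, p x₁ x₂ x₃ true r₂ true :=
      Finset.sum_pos (fun x₂ _ => Finset.sum_pos
        (fun r₂ _ => hppos x₁ x₂ x₃ true r₂ true) ⟨true, Finset.mem_univ _⟩)
        ⟨y₂, Finset.mem_univ _⟩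
    rw [ha₂, div_eq_iff hpos.ne']
    simp only [sum_r₂]
    simp only [hp, Finset.mul_sum]
    exact Finset.sum_congr rfl fun _ _ => by ring
  have hb₂_eq : ∀ r₁ x₃, b₂ r₁ x₃ = ∑ x₁, q₁ x₁ * w₂ true r₁ x₁ x₃ := by
    intro r₁ x₃
    have hpos : 0 < ∑ x₁, ∑ x₂, ∑ r₂, p x₁ x₂ x₃ r₁ r₂ true :=
      Finset.sum_pos (fun x₁ _ => Finset.sum_pos (fun x₂ _ => Finset.sum_pos
        (fun r₂ _ => hppos x₁ x₂ x₃ r₁ r₂ true) ⟨true, Finset.mem_univ _⟩)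
        ⟨y₂, Finset.mem_univ _⟩) ⟨y₁, Finset.mem_univ _⟩
    have hden : ∑ x₁, ∑ x₂, ∑ r₂, p x₁ x₂ x₃ r₁ r₂ true
        = ∑ x₂, q₂ x₂ * q₃ x₃ x₂ * w₁ r₁ x₂ * w₃ true r₁ x₂ := by
      rw [← one_mul (∑ x₂, q₂ x₂ * _ * _ * _), ← hq₁s, Finset.sum_mul_sum]
      simp only [sum_r₂]
      exact Finset.sum_congr rfl fun _ _ => Finset.sum_congr rfl fun _ _ => by ring
    rw [hb₂, div_eq_iff hpos.ne', hden, Finset.sum_mul_sum]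
    simp only [hp]
    exact Finset.sum_congr rfl fun _ _ => Finset.sum_congr rfl fun _ _ => by ring
  have weighted : ∀ x₂ x₃ r₁, (∑ x₁, p x₁ x₂ x₃ r₁ true true) / (b₂ r₁ x₃ * a₃ r₁ x₂)
      = q₂ x₂ * w₁ r₁ x₂ * q₃ x₃ x₂ := by
    intro x₂ x₃ r₁
    have hb : 0 < b₂ r₁ x₃ := by
      rw [hb₂_eq]
      refine Finset.sum_pos (fun x₁ _ => ?_) ⟨y₁, Finset.mem_univ _⟩
      obtain ⟨h₁, -, -, h₅, -⟩ := factors_pos x₁ x₂ x₃ r₁ true true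
      exact mul_pos h₁ h₅
    have ha : 0 < a₃ r₁ x₂ := by
      rw [ha₃_eq]
      exact (factors_pos y₁ x₂ x₃ r₁ true true).2.2.2.2
    rw [div_eq_iff (mul_pos hb ha).ne', ha₃_eq, hb₂_eq, Finset.sum_mul, Finset.mul_sum]
    simp only [hp]
    exact Finset.sum_congr rfl fun _ _ => by ring
  refine ⟨ha₃_eq, ha₂_eq, hb₂_eq, fun x₂ => ?_, fun x₁ x₂ x₃ => ?_⟩
  · have hq₂ : q₂ x₂ ≠ 0 := (factors_pos y₁ x₂ y₃ true true true).2.1.ne'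
    simp only [weighted, ← Finset.sum_mul, ← Finset.mul_sum, hw₁s, hq₃s, mul_one]
    rw [mul_div_cancel_left₀ _ hq₂]
  · obtain ⟨-, -, h₄, h₅, h₆⟩ := factors_pos x₁ x₂ x₃ true true true
    rw [ha₂_eq, ha₃_eq, eq_div_iff (mul_pos (mul_pos h₄ h₅) h₆).ne']
    simp only [sum_r₃, ← Finset.mul_sum, hw₂s, hw₁s, mul_one]
    rw [hp]
    ring
end

section
/- Propensity-score identification requiring intervention on a fully observed variable (the model of Fig. 6(a)): let (X_1, X_2, L_3, X_4, R_1, R_2, R_4) have a strictly positive joint probability mass function on a finite product space that factorizes as q_1(x_1)·q_2(x_2)·q_3(l_3|x_1,x_2)·q_4(x_4|l_3)·π_4(r_4|l_3)·π_2(r_2|x_1,x_4)·π_1(r_1|r_2,x_2,x_4), where L_3 is always observed, each factor is a probability mass function in its first argument, and X_1, X_2, X_4 have missingness indicators R_1, R_2, R_4 ∈ {0,1}. Define a(l_3, x_4) := P(R_4 = 1 | L_3 = l_3) · P(X_4 = x_4 | L_3 = l_3, R_4 = 1); D(r_1, r_2, x_4) := Σ_{l_3} P(L_3 = l_3, X_4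 = x_4, R_1 = r_1, R_2 = r_2, R_4 = 1)/a(l_3, x_4); N(x_1, r_2, x_4) := Σ_{l_3} P(X_1 = x_1, L_3 = l_3, X_4 = x_4, R_1 = 1, R_2 = r_2, R_4 = 1)/a(l_3, x_4); and β(r_2, x_4) := D(1, r_2, x_4)/(D(0, r_2, x_4) + D(1, r_2, x_4)). Then: (i) π_1(1|1, x_2, x_4) = P(R_1 = 1 | R_2 = 1, R_4 = 1, X_2 = x_2, X_4 = x_4); (ii) π_2(1|x_1, x_4) = [ N(x_1, 1, x_4)/β(1, x_4) ] / [ N(x_1, 0, x_4)/β(0, x_4) + N(x_1, 1, x_4)/β(1, x_4) ]; and (iii) the target law is P(X_1=x_1, X_2=x_2, L_3=l_3, X_4=x_4) = P(X_1=x_1, X_2=x_2, L_3=l_3, X_4=x_4, R_1=1, R_2=1, R_4=1) / ( π_1(1|1,x_2,x_4) · π_2(1|x_1,x_4) · P(R_4=1 | L_3=l_3) ). Every probability on the right-hand sides conditions each of X_1, X_2, X_4 on its indicator being 1, hence is a functional of the observed-data law. -/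
/-- propensity-score identification requiring intervention on a fully observed
variable (the model of Fig. 6(a)).  The joint pmf of `(X₁, X₂, L₃, X₄, R₁, R₂, R₄)`
factorizes as
`q₁(x₁) q₂(x₂) q₃(l₃|x₁,x₂) q₄(x₄|l₃) w₄(r₄|l₃) w₂(r₂|x₁,x₄) w₁(r₁|r₂,x₂,x₄)`,
where `L₃` is always observed.  With
`a(l₃,x₄) = P(R₄=1 | L₃=l₃) · P(X₄=x₄ | L₃=l₃, R₄=1)`,
`D(r₁,r₂,x₄) = Σ_{l₃} P(L₃=l₃, X₄=x₄, R₁=r₁, R₂=r₂, R₄=1)/a(l₃,x₄)`,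
`N(x₁,r₂,x₄) = Σ_{l₃} P(X₁=x₁, L₃=l₃, X₄=x₄, R₁=1, R₂=r₂, R₄=1)/a(l₃,x₄)` and
`β(r₂,x₄) = D(1,r₂,x₄)/(D(0,r₂,x₄)+D(1,r₂,x₄))`, the propensity scores and the target law
are identified. -/
theorem intervene_on_observed_var_id
    {α₁ α₂ α₃ α₄ : Type*} [Fintype α₁] [Nonempty α₁] [Fintype α₂] [Nonempty α₂]
    [Fintype α₃] [Nonempty α₃] [Fintype α₄] [Nonempty α₄]
    (q₁ : α₁ → ℝ) (q₂ : α₂ → ℝ) (q₃ : α₃ → α₁ → α₂ → ℝ) (q₄ : α₄ → α₃ → ℝ)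
    (w₄ : Bool → α₃ → ℝ) (w₂ : Bool → α₁ → α₄ → ℝ) (w₁ : Bool → Bool → α₂ → α₄ → ℝ)
    -- each factor is a probability mass function in its first argument
    (hq₁nn : ∀ x₁, 0 ≤ q₁ x₁) (hq₁s : ∑ x₁, q₁ x₁ = 1)
    (hq₂nn : ∀ x₂, 0 ≤ q₂ x₂) (hq₂s : ∑ x₂, q₂ x₂ = 1)
    (hq₃nn : ∀ l₃ x₁ x₂, 0 ≤ q₃ l₃ x₁ x₂) (hq₃s : ∀ x₁ x₂, ∑ l₃, q₃ l₃ x₁ x₂ = 1)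
    (hq₄nn : ∀ x₄ l₃, 0 ≤ q₄ x₄ l₃) (hq₄s : ∀ l₃, ∑ x₄, q₄ x₄ l₃ = 1)
    (hw₄nn : ∀ r₄ l₃, 0 ≤ w₄ r₄ l₃) (hw₄s : ∀ l₃, ∑ r₄, w₄ r₄ l₃ = 1)
    (hw₂nn : ∀ r₂ x₁ x₄, 0 ≤ w₂ r₂ x₁ x₄) (hw₂s : ∀ x₁ x₄, ∑ r₂, w₂ r₂ x₁ x₄ = 1)
    (hw₁nn : ∀ r₁ r₂ x₂ x₄, 0 ≤ w₁ r₁ r₂ x₂ x₄) (hw₁s : ∀ r₂ x₂ x₄, ∑ r₁, w₁ r₁ r₂ x₂ x₄ = 1)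
    -- the joint pmf and its factorization
    (p : α₁ → α₂ → α₃ → α₄ → Bool → Bool → Bool → ℝ)
    (hp : ∀ x₁ x₂ l₃ x₄ r₁ r₂ r₄,
      p x₁ x₂ l₃ x₄ r₁ r₂ r₄
        = q₁ x₁ * q₂ x₂ * q₃ l₃ x₁ x₂ * q₄ x₄ l₃ * w₄ r₄ l₃ * w₂ r₂ x₁ x₄
          * w₁ r₁ r₂ x₂ x₄)
    -- strict positivity of the joint pmf
    (hppos : ∀ x₁ x₂ l₃ x₄ r₁ r₂ r₄, 0 < p x₁ x₂ l₃ x₄ r₁ r₂ r₄)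
    -- PR₄ l₃ := P(R₄ = 1 | L₃ = l₃)
    (PR₄ : α₃ → ℝ)
    (hPR₄ : ∀ l₃, PR₄ l₃
      = (∑ x₁, ∑ x₂, ∑ x₄, ∑ r₁, ∑ r₂, p x₁ x₂ l₃ x₄ r₁ r₂ true)
        / (∑ x₁, ∑ x₂, ∑ x₄, ∑ r₁, ∑ r₂, ∑ r₄, p x₁ x₂ l₃ x₄ r₁ r₂ r₄))
    -- a(l₃, x₄) := P(R₄ = 1 | L₃ = l₃) · P(X₄ = x₄ | L₃ = l₃, R₄ = 1)
    (a : α₃ → α₄ → ℝ)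
    (ha : ∀ l₃ x₄, a l₃ x₄
      = PR₄ l₃ * ((∑ x₁, ∑ x₂, ∑ r₁, ∑ r₂, p x₁ x₂ l₃ x₄ r₁ r₂ true)
          / (∑ x₁, ∑ x₂, ∑ x₄', ∑ r₁, ∑ r₂, p x₁ x₂ l₃ x₄' r₁ r₂ true)))
    -- D(r₁, r₂, x₄) := Σ_{l₃} P(L₃ = l₃, X₄ = x₄, R₁ = r₁, R₂ = r₂, R₄ = 1) / a(l₃, x₄)
    (D : Bool → Bool → α₄ → ℝ)
    (hD : ∀ r₁ r₂ x₄, D r₁ r₂ x₄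
      = ∑ l₃, (∑ x₁, ∑ x₂, p x₁ x₂ l₃ x₄ r₁ r₂ true) / a l₃ x₄)
    -- N(x₁, r₂, x₄) := Σ_{l₃} P(X₁ = x₁, L₃ = l₃, X₄ = x₄, R₁ = 1, R₂ = r₂, R₄ = 1) / a(l₃, x₄)
    (N : α₁ → Bool → α₄ → ℝ)
    (hN : ∀ x₁ r₂ x₄, N x₁ r₂ x₄
      = ∑ l₃, (∑ x₂, p x₁ x₂ l₃ x₄ true r₂ true) / a l₃ x₄)
    -- β(r₂, x₄) := D(1, r₂, x₄) / (D(0, r₂, x₄) + D(1, r₂, x₄))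
    (β : Bool → α₄ → ℝ)
    (hβ : ∀ r₂ x₄, β r₂ x₄ = D true r₂ x₄ / (D false r₂ x₄ + D true r₂ x₄)) :
    -- (i) the propensity score of R₁ is identified
    (∀ x₂ x₄, w₁ true true x₂ x₄
      = (∑ x₁, ∑ l₃, p x₁ x₂ l₃ x₄ true true true)
        / (∑ x₁, ∑ l₃, ∑ r₁, p x₁ x₂ l₃ x₄ r₁ true true)) ∧
    -- (ii) the propensity score of R₂ is identified
    (∀ x₁ x₄, w₂ true x₁ x₄
      = (N x₁ true x₄ / β true x₄)
        / (N x₁ false x₄ / β false x₄ + N x₁ true x₄ / β true x₄)) ∧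
    -- (iii) the target law is identified
    (∀ x₁ x₂ l₃ x₄,
      (∑ r₁, ∑ r₂, ∑ r₄, p x₁ x₂ l₃ x₄ r₁ r₂ r₄)
        = p x₁ x₂ l₃ x₄ true true true
          / (w₁ true true x₂ x₄ * w₂ true x₁ x₄ * PR₄ l₃)) := by
  have factors_pos (x₁ x₂ l₃ x₄ r₁ r₂ r₄) :
      0 < q₁ x₁ ∧ 0 < q₂ x₂ ∧ 0 < q₃ l₃ x₁ x₂ ∧ 0 < q₄ x₄ l₃ ∧ 0 < w₄ r₄ l₃ ∧
        0 < w₂ r₂ x₁ x₄ ∧ 0 < w₁ r₁ r₂ x₂ x₄ := by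
    have h := (hppos x₁ x₂ l₃ x₄ r₁ r₂ r₄).ne'
    rw [hp] at h
    simp only [mul_ne_zero_iff] at h
    obtain ⟨⟨⟨⟨⟨⟨h₁, h₂⟩, h₃⟩, h₄⟩, h₅⟩, h₆⟩, h₇⟩ := h
    exact ⟨(hq₁nn _).lt_of_ne' h₁, (hq₂nn _).lt_of_ne' h₂, (hq₃nn _ _ _).lt_of_ne' h₃,
      (hq₄nn _ _).lt_of_ne' h₄, (hw₄nn _ _).lt_of_ne' h₅, (hw₂nn _ _ _).lt_of_ne' h₆,
      (hw₁nn _ _ _ _).lt_of_ne' h₇⟩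
  obtain ⟨y₁⟩ := ‹Nonempty α₁›
  obtain ⟨y₂⟩ := ‹Nonempty α₂›
  obtain ⟨m₃⟩ := ‹Nonempty α₃›
  obtain ⟨y₄⟩ := ‹Nonempty α₄›
  have hq₁pos (x₁) : 0 < q₁ x₁ := (factors_pos x₁ y₂ m₃ y₄ true true true).1
  have hq₂pos (x₂) : 0 < q₂ x₂ := (factors_pos y₁ x₂ m₃ y₄ true true true).2.1
  have hq₃pos (l₃ x₁ x₂) : 0 < q₃ l₃ x₁ x₂ := (factors_pos x₁ x₂ l₃ y₄ true true true).2.2.1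
  have hq₄pos (x₄ l₃) : 0 < q₄ x₄ l₃ := (factors_pos y₁ y₂ l₃ x₄ true true true).2.2.2.1
  have hw₄pos (r₄ l₃) : 0 < w₄ r₄ l₃ := (factors_pos y₁ y₂ l₃ y₄ true true r₄).2.2.2.2.1
  have hw₂pos (r₂ x₁ x₄) : 0 < w₂ r₂ x₁ x₄ :=
    (factors_pos x₁ y₂ m₃ x₄ true r₂ true).2.2.2.2.2.1
  have hw₁pos (r₁ r₂ x₂ x₄) : 0 < w₁ r₁ r₂ x₂ x₄ :=
    (factors_pos y₁ x₂ m₃ x₄ r₁ r₂ true).2.2.2.2.2.2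
  -- marginals of the joint law
  have sum_r₁r₂ (x₁ x₂ l₃ x₄ r₄) : ∑ r₁, ∑ r₂, p x₁ x₂ l₃ x₄ r₁ r₂ r₄
      = q₁ x₁ * q₂ x₂ * q₃ l₃ x₁ x₂ * q₄ x₄ l₃ * w₄ r₄ l₃ := by
    rw [Finset.sum_comm]
    simp only [hp, ← Finset.mul_sum, hw₁s, hw₂s, mul_one]
  have sum_r (x₁ x₂ l₃ x₄) : ∑ r₁, ∑ r₂, ∑ r₄, p x₁ x₂ l₃ x₄ r₁ r₂ r₄
      = q₁ x₁ * q₂ x₂ * q₃ l₃ x₁ x₂ * q₄ x₄ l₃ := by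
    have h : ∑ r₁, ∑ r₂, ∑ r₄, p x₁ x₂ l₃ x₄ r₁ r₂ r₄
        = ∑ r₄, ∑ r₁, ∑ r₂, p x₁ x₂ l₃ x₄ r₁ r₂ r₄ := by
      simp only [Fintype.sum_bool]; ring
    rw [h]
    simp only [sum_r₁r₂, ← Finset.mul_sum, hw₄s, mul_one]
  have marginal_l₃_pos (l₃) : 0 < ∑ x₁, ∑ x₂, q₁ x₁ * q₂ x₂ * q₃ l₃ x₁ x₂ :=
    Finset.sum_pos (fun x₁ _ => Finset.sum_pos
      (fun x₂ _ => mul_pos (mul_pos (hq₁pos x₁) (hq₂pos x₂)) (hq₃pos l₃ x₁ x₂))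
      ⟨y₂, Finset.mem_univ _⟩) ⟨y₁, Finset.mem_univ _⟩
  have sum_r₄_true (l₃) : ∑ x₁, ∑ x₂, ∑ x₄, ∑ r₁, ∑ r₂, p x₁ x₂ l₃ x₄ r₁ r₂ true
      = (∑ x₁, ∑ x₂, q₁ x₁ * q₂ x₂ * q₃ l₃ x₁ x₂) * w₄ true l₃ := by
    simp only [sum_r₁r₂, ← Finset.sum_mul, ← Finset.mul_sum, hq₄s, mul_one]
  have PR₄_eq (l₃) : PR₄ l₃ = w₄ true l₃ := by
    rw [hPR₄, sum_r₄_true]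
    simp only [sum_r, ← Finset.mul_sum, hq₄s, mul_one]
    exact mul_div_cancel_left₀ _ (by simpa only [Finset.mul_sum] using (marginal_l₃_pos l₃).ne')
  have a_eq (l₃ x₄) : a l₃ x₄ = w₄ true l₃ * q₄ x₄ l₃ := by
    have h := marginal_l₃_pos l₃
    have h' := hw₄pos true l₃
    rw [ha, PR₄_eq, sum_r₄_true]
    simp only [sum_r₁r₂, ← Finset.sum_mul]
    field_simp
  have p_div_a (x₁ x₂ l₃ x₄ r₁ r₂) : p x₁ x₂ l₃ x₄ r₁ r₂ true / a l₃ x₄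
      = q₁ x₁ * w₂ r₂ x₁ x₄ * (q₂ x₂ * w₁ r₁ r₂ x₂ x₄) * q₃ l₃ x₁ x₂ := by
    have h := hw₄pos true l₃
    have h' := hq₄pos x₄ l₃
    rw [hp, a_eq]
    field_simp
  have N_eq (x₁ r₂ x₄) : N x₁ r₂ x₄
      = q₁ x₁ * w₂ r₂ x₁ x₄ * ∑ x₂, q₂ x₂ * w₁ true r₂ x₂ x₄ := by
    simp only [hN, Finset.sum_div, p_div_a]
    rw [Finset.sum_comm]
    simp only [← Finset.mul_sum, hq₃s, mul_one]
  have D_eq (r₁ r₂ x₄) : D r₁ r₂ x₄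
      = (∑ x₁, q₁ x₁ * w₂ r₂ x₁ x₄) * ∑ x₂, q₂ x₂ * w₁ r₁ r₂ x₂ x₄ := by
    simp only [hD, Finset.sum_div, p_div_a]
    rw [Finset.sum_comm, Finset.sum_mul]
    refine Finset.sum_congr rfl fun x₁ _ => ?_
    rw [Finset.sum_comm]
    simp only [← Finset.mul_sum, hq₃s, mul_one]
  have β_eq (r₂ x₄) : β r₂ x₄ = ∑ x₂, q₂ x₂ * w₁ true r₂ x₂ x₄ := by
    have hA : 0 < ∑ x₁, q₁ x₁ * w₂ r₂ x₁ x₄ :=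
      Finset.sum_pos (fun x₁ _ => mul_pos (hq₁pos x₁) (hw₂pos r₂ x₁ x₄))
        ⟨y₁, Finset.mem_univ _⟩
    have hB : ∑ x₂, q₂ x₂ * w₁ false r₂ x₂ x₄ + ∑ x₂, q₂ x₂ * w₁ true r₂ x₂ x₄ = 1 := by
      rw [← Finset.sum_add_distrib, ← hq₂s]
      refine Finset.sum_congr rfl fun x₂ _ => ?_
      have h := hw₁s r₂ x₂ x₄
      rw [Fintype.sum_bool] at h
      rw [← mul_add, add_comm, h, mul_one]
    rw [hβ, D_eq, D_eq, ← mul_add, hB, mul_one, mul_div_cancel_left₀ _ hA.ne']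
  have N_div_β (x₁ r₂ x₄) : N x₁ r₂ x₄ / β r₂ x₄ = q₁ x₁ * w₂ r₂ x₁ x₄ := by
    rw [N_eq, β_eq]
    exact mul_div_cancel_right₀ _ (Finset.sum_pos
      (fun x₂ _ => mul_pos (hq₂pos x₂) (hw₁pos true r₂ x₂ x₄)) ⟨y₂, Finset.mem_univ _⟩).ne'
  refine ⟨fun x₂ x₄ => ?_, fun x₁ x₄ => ?_, fun x₁ x₂ l₃ x₄ => ?_⟩
  · simp only [hp, ← Finset.mul_sum, hw₁s, mul_one, ← Finset.sum_mul]
    refine (mul_div_cancel_left₀ _ (Finset.sum_pos (fun x₁ _ => mul_pos (Finset.sum_pos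
      (fun l₃ _ => ?_) ⟨m₃, Finset.mem_univ _⟩) (hw₂pos _ _ _)) ⟨y₁, Finset.mem_univ _⟩).ne').symm
    exact mul_pos (mul_pos (mul_pos (mul_pos (hq₁pos _) (hq₂pos _)) (hq₃pos _ _ _))
      (hq₄pos _ _)) (hw₄pos _ _)
  · have h := hw₂s x₁ x₄
    rw [Fintype.sum_bool, add_comm] at h
    rw [N_div_β, N_div_β, ← mul_add, h, mul_one, mul_div_cancel_left₀ _ (hq₁pos x₁).ne']
  · have h₁ := hw₁pos true true x₂ x₄
    have h₂ := hw₂pos true x₁ x₄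
    have h₄ := hw₄pos true l₃
    rw [sum_r, hp, PR₄_eq]
    field_simp
end

section
/- Identification in the K-variable causal analogue of the block-parallel model under rank preservation: let A_1,…,A_K ∈ {0,1} be treatments, and for each k let X_k^{(0)}, X_k^{(1)} be counterfactual variables with values in a finite set α_k, with observed outcomes X_k := X_k^{(A_k)} (consistency). Assume the joint law is strictly positive on its finite state space and: (C) for every k, P(A_k = a_k | {X_j^{(0)}, X_j^{(1)} : j = 1,…,K}, {A_j : j ≠ k}) = P(A_k = a_k | {X_j^{(0)}, X_j^{(1)} : j ≠ k}) pointwise; and (RP) rank preservation: for every k there exists a bijection g_k : α_k → α_k with X_k^{(0)} = g_k(X_k^{(1)}) everywhere on Ω. Then for every treatment pattern a = (a_1,…,a_K) ∈ {0,1}^K and all values x = (x_1,…,x_K): P(X_1^{(a_1)} = x_1, …, X_K^{(a_K)} = x_K) = P(X_1 = x_1, …, X_K = x_K, A = a) / ∏_{k=1}^K P(A_k = a_k | X_{−k} = x_{−k}, A_{−k} = a_{−k}), where the subscript −k denotes all coordinates other than k. -/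
open MeasureTheory

/-- A probability splits as a sum over the fibres of a finitely valued map. -/
lemma Pr_eq_sum_fiber {Ω ι : Type*} [MeasurableSpace Ω] [Fintype ι] (P : Measure Ω)
    [IsFiniteMeasure P] (f : Ω → ι) (hf : ∀ i, MeasurableSet {ω | f ω = i}) (E : Set Ω) :
    Pr P E = ∑ i, Pr P ({ω | f ω = i} ∩ E) := by
  have h := sum_measure_preimage_singleton (μ := P.restrict E) (f := f) Finset.univ
    (fun i _ => hf i)
  have hi : ∀ i, P.restrict E (f ⁻¹' {i}) = P ({ω | f ω = i} ∩ E) :=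
    fun i => Measure.restrict_apply (hf i)
  simp only [hi, Finset.coe_univ, Set.preimage_univ, Measure.restrict_apply_univ] at h
  unfold Pr
  rw [← h, ENNReal.toReal_sum fun i _ => measure_ne_top P _]

/-- A conditional probability distribution of a finitely valued map sums to one. -/
lemma sum_cPr_fiber {Ω ι : Type*} [MeasurableSpace Ω] [Fintype ι] (P : Measure Ω)
    [IsFiniteMeasure P] (f : Ω → ι) (hf : ∀ i, MeasurableSet {ω | f ω = i}) {B : Set Ω}
    (hB : Pr P B ≠ 0) : ∑ i, cPr P {ω | f ω = i} B = 1 := by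
  unfold cPr
  rw [← Finset.sum_div, ← Pr_eq_sum_fiber P f hf, div_self hB]

/-- If the conditional probability of `A` is constant on the pieces of a finite partition of `B`,
it has the same value on `B`. -/
lemma cPr_eq_of_forall_fiber {Ω ι : Type*} [MeasurableSpace Ω] [Fintype ι] (P : Measure Ω)
    [IsFiniteMeasure P] (f : Ω → ι) (hf : ∀ i, MeasurableSet {ω | f ω = i}) {A B : Set Ω} {q : ℝ}
    (hpos : ∀ i, Pr P ({ω | f ω = i} ∩ B) ≠ 0) (hB : Pr P B ≠ 0)
    (h : ∀ i, cPr P A ({ω | f ω = i} ∩ B) = q) : cPr P A B = q := by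
  unfold cPr at h ⊢
  rw [div_eq_iff hB, Pr_eq_sum_fiber P f hf (A ∩ B), Pr_eq_sum_fiber P f hf B, Finset.mul_sum]
  refine Finset.sum_congr rfl fun i _ => ?_
  rw [← (div_eq_iff (hpos i)).1 (h i), Set.inter_left_comm]

/-- A weight on a finite product all of whose full conditionals are `q k` is, up to its total mass,
the product of the `q k`. -/
lemma eq_prod_mul_sum_of_update {κ β : Type*} [Fintype κ] [DecidableEq κ] [Fintype β]
    (p : (κ → β) → ℝ) (q : κ → β → ℝ) (r : κ → (κ → β) → ℝ)
    (hp : ∀ k c b, p (Function.update c k b) = q k b * r k c)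
    (hq : ∀ k, ∑ b, q k b = 1) (a : κ → β) :
    p a = (∏ k, q k (a k)) * ∑ c, p c := by
  have hswap : ∀ (c : κ → β) (S : Finset κ),
      p (S.piecewise c a) * ∏ k ∈ S, q k (a k) = p a * ∏ k ∈ S, q k (c k) := by
    intro c S
    induction S using Finset.induction_on with
    | empty => simp
    | insert k S hk ih =>
      have h1 := hp k (S.piecewise c a) (c k)
      have h2 := hp k (S.piecewise c a) (a k)
      rw [Function.update_eq_self_iff.2 (S.piecewise_eq_of_notMem c a hk).symm] at h2
      rw [Finset.piecewise_insert, Finset.prod_insert hk, Finset.prod_insert hk, h1]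
      rw [h2] at ih
      linear_combination q k (c k) * ih
  have hsum : ∑ c : κ → β, ∏ k, q k (c k) = 1 := by
    rw [← Fintype.prod_sum]
    simp [hq]
  calc p a = p a * ∑ c : κ → β, ∏ k, q k (c k) := by rw [hsum, mul_one]
    _ = (∏ k, q k (a k)) * ∑ c, p c := by
      rw [Finset.mul_sum, Finset.mul_sum]
      refine Finset.sum_congr rfl fun c _ => ?_
      simpa [mul_comm] using (hswap c Finset.univ).symm

/-- identification in the K-variable causal analogue of the block-parallel
model under rank preservation. -/
theorem K_variable_block_parallel_causal_rank_preservation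
    {Ω : Type*} [MeasurableSpace Ω] (P : Measure Ω) [IsProbabilityMeasure P]
    {K : ℕ} {α : Fin K → Type*} [∀ k, Fintype (α k)] [∀ k, Nonempty (α k)]
    (A : Fin K → Ω → Bool) (Xc : ∀ k : Fin K, Bool → Ω → α k) (X : ∀ k, Ω → α k)
    -- consistency
    (hX : ∀ (k : Fin K) (ω : Ω), X k ω = Xc k (A k ω) ω)
    -- measurability of the random variables
    (hmA : ∀ (k : Fin K) (b : Bool), MeasurableSet {ω | A k ω = b})
    (hmXc : ∀ (k : Fin K) (b : Bool) (a : α k), MeasurableSet {ω | Xc k b ω = a})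
    -- strict positivity of the joint law
    (hpos : ∀ (x : ∀ k, α k) (a : Fin K → Bool),
      0 < Pr P {ω | (∀ k, X k ω = x k) ∧ (∀ k, A k ω = a k)})
    -- (C)
    (hC : ∀ (k : Fin K) (ak : Bool) (u : ∀ j, Bool → α j) (a : Fin K → Bool),
      0 < Pr P {ω | (∀ j b, Xc j b ω = u j b) ∧ (∀ j, j ≠ k → A j ω = a j)} →
      cPr P {ω | A k ω = ak}
        {ω | (∀ j b, Xc j b ω = u j b) ∧ (∀ j, j ≠ k → A j ω = a j)}
        = cPr P {ω | A k ω = ak} {ω | ∀ j, j ≠ k → ∀ b, Xc j b ω = u j b})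
    -- (RP) rank preservation
    (g : ∀ k : Fin K, α k ≃ α k)
    (hRP : ∀ (k : Fin K) (ω : Ω), Xc k false ω = g k (Xc k true ω)) :
    ∀ (a : Fin K → Bool) (x : ∀ k, α k),
      Pr P {ω | ∀ k, Xc k (a k) ω = x k}
        = Pr P {ω | (∀ k, X k ω = x k) ∧ (∀ k, A k ω = a k)}
          / ∏ k, cPr P {ω | A k ω = a k}
              {ω | (∀ j, j ≠ k → X j ω = x j) ∧ (∀ j, j ≠ k → A j ω = a j)} := by
  intro a x
  let u : (∀ j, α j) → ∀ j, Bool → α j := fun v j b => bif b then v j else g j (v j)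
  have hu_iff : ∀ v j (b : Bool) ω, Xc j b ω = u v j b ↔ Xc j true ω = v j := by
    intro v j b ω
    cases b
    · simp [u, hRP]
    · simp [u]
  have hX_iff : ∀ v j (c : Bool) ω, A j ω = c → (X j ω = u v j c ↔ Xc j true ω = v j) := by
    intro v j c ω h
    rw [hX, h, hu_iff]
  obtain ⟨v, hv⟩ : ∃ v, ∀ j, u v j (a j) = x j := by
    refine ⟨fun j => bif a j then x j else (g j).symm (x j), fun j => ?_⟩
    cases h : a j <;> simp [u, h]
  have hPr_ne : ∀ (v : ∀ j, α j) (c : Fin K → Bool) (E : Set Ω),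
      {ω | (∀ j, Xc j true ω = v j) ∧ ∀ j, A j ω = c j} ⊆ E → Pr P E ≠ 0 := by
    intro v c E hE
    refine ne_of_gt ((hpos (fun j => u v j (c j)) c).trans_le
      (ENNReal.toReal_mono (measure_ne_top P E) (measure_mono ?_)))
    rintro ω ⟨h1, h2⟩
    exact hE ⟨fun j => (hX_iff v j _ ω (h2 j)).1 (h1 j), h2⟩
  have hmU : ∀ k (w : α k), MeasurableSet {ω | Xc k true ω = w} := fun k w => hmXc k true w
  -- the full conditionals of the treatments
  let q : Fin K → Bool → ℝ := fun k b =>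
    cPr P {ω | A k ω = b} {ω | ∀ j, j ≠ k → Xc j true ω = v j}
  have hq_ne : ∀ k, Pr P {ω | ∀ j, j ≠ k → Xc j true ω = v j} ≠ 0 := fun k =>
    hPr_ne v a _ fun ω h j _ => h.1 j
  have hcond : ∀ k b (c : Fin K → Bool) (w : ∀ j, α j), (∀ j, j ≠ k → w j = v j) →
      cPr P {ω | A k ω = b} {ω | (∀ j, Xc j true ω = w j) ∧ ∀ j, j ≠ k → A j ω = c j}
        = q k b := by
    intro k b c w hw
    have h := hC k b (u w) c (ENNReal.toReal_nonneg.lt_of_ne'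
      (hPr_ne w c _ fun ω h => ⟨fun j b => (hu_iff w j b ω).2 (h.1 j), fun j _ => h.2 j⟩))
    simp only [hu_iff, forall_const] at h
    rw [h]
    have : {ω | ∀ j, j ≠ k → Xc j true ω = w j} = {ω | ∀ j, j ≠ k → Xc j true ω = v j} := by
      ext ω
      exact forall₂_congr fun j hj => by rw [hw j hj]
    rw [this]
  have hfactor := eq_prod_mul_sum_of_update
    (fun c => Pr P {ω | (∀ j, Xc j true ω = v j) ∧ ∀ j, A j ω = c j}) q
    (fun k c => Pr P {ω | (∀ j, Xc j true ω = v j) ∧ ∀ j, j ≠ k → A j ω = c j})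
    (by
      intro k c b
      have h := hcond k b c v fun _ _ => rfl
      have hne : Pr P {ω | (∀ j, Xc j true ω = v j) ∧ ∀ j, j ≠ k → A j ω = c j} ≠ 0 :=
        hPr_ne v c _ fun ω h => ⟨h.1, fun j _ => h.2 j⟩
      rw [cPr, div_eq_iff hne] at h
      rw [← h]
      congr 1
      ext ω
      simp only [Set.mem_ofPred_eq, Set.mem_inter_iff,
        Function.forall_update_iff c (p := fun j y => A j ω = y)]
      tauto)
    (fun k => sum_cPr_fiber P (A k) (hmA k) (hq_ne k)) a
  have htotal : ∑ c : Fin K → Bool, Pr P {ω | (∀ j, Xc j true ω = v j) ∧ ∀ j, A j ω = c j}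
      = Pr P {ω | ∀ j, Xc j (a j) ω = x j} := by
    rw [Pr_eq_sum_fiber P (fun ω j => A j ω)]
    · refine Finset.sum_congr rfl fun c _ => congrArg (Pr P) ?_
      ext ω
      simp only [Set.mem_ofPred_eq, Set.mem_inter_iff, funext_iff, ← hv, hu_iff]
      tauto
    · intro c
      simp only [funext_iff, Set.ofPred_forall]
      exact MeasurableSet.iInter fun j => hmA j (c j)
  have hnum : {ω | (∀ k, X k ω = x k) ∧ (∀ k, A k ω = a k)}
      = {ω | (∀ j, Xc j true ω = v j) ∧ ∀ j, A j ω = a j} := by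
    ext ω
    refine and_congr_left fun h => forall_congr' fun j => ?_
    rw [← hv, hX_iff v j _ ω (h j)]
  have hden : ∀ k, cPr P {ω | A k ω = a k}
      {ω | (∀ j, j ≠ k → X j ω = x j) ∧ (∀ j, j ≠ k → A j ω = a j)} = q k (a k) := by
    intro k
    have hset : {ω | (∀ j, j ≠ k → X j ω = x j) ∧ (∀ j, j ≠ k → A j ω = a j)}
        = {ω | (∀ j, j ≠ k → Xc j true ω = v j) ∧ (∀ j, j ≠ k → A j ω = a j)} := by
      ext ω
      refine and_congr_left fun h => forall₂_congr fun j hj => ?_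
      rw [← hv, hX_iff v j _ ω (h j hj)]
    have hfib : ∀ w, {ω | Xc k true ω = w} ∩
        {ω | (∀ j, j ≠ k → Xc j true ω = v j) ∧ (∀ j, j ≠ k → A j ω = a j)}
        = {ω | (∀ j, Xc j true ω = Function.update v k w j) ∧ ∀ j, j ≠ k → A j ω = a j} := by
      intro w
      ext ω
      simp only [Set.mem_ofPred_eq, Set.mem_inter_iff,
        Function.forall_update_iff v (p := fun j y => Xc j true ω = y), and_assoc]
    rw [hset]
    refine cPr_eq_of_forall_fiber P (Xc k true) (hmU k) (fun w => ?_) ?_ fun w => ?_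
    · rw [hfib]
      exact hPr_ne (Function.update v k w) a _ fun ω h => ⟨h.1, fun j _ => h.2 j⟩
    · exact hPr_ne v a _ fun ω h => ⟨fun j _ => h.1 j, fun j _ => h.2 j⟩
    · rw [hfib]
      exact hcond k _ a _ fun j hj => Function.update_of_ne hj w v
  have hne : ∏ k, q k (a k) ≠ 0 := by
    intro h
    have := hPr_ne v a _ subset_rfl
    simp only [h, zero_mul] at hfactor
    exact this hfactor
  rw [hnum, Finset.prod_congr rfl fun k _ => hden k, eq_div_iff hne, ← htotal, mul_comm]
  exact hfactor.symm
end
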